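/- Let p be a prime, V = (F_p)³, and G ⊆ SL(3, F_p) = SL(V) a finite subgroup such that F_p v₀ is a 1-dimensional G-submodule of V, V contains no 2-dimensional G-submodule, and the quotient W = V/F_p v₀ is an irreducible G-module. Then the invariant ring S(V)^G is Gorenstein. -/

import Mathlib

noncomputable section
open CategoryTheory Matrix MvPolynomial

universe u

/-- A module `M` over `R` has finite injective dimension iff the Ext functors
`Ext^i(-, M)` vanish for all sufficiently large `i`. -/
def HasFiniteInjectiveDimension (R : Type u) [CommRing R] (M : ModuleCat.{u} R) : Prop :=
  ∃ n : ℕ, ∀ (N : ModuleCat.{u} R) (i : ℕ), n < i →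
    Subsingleton (((Ext R (ModuleCat.{u} R) i).obj (Opposite.op N)).obj M)

/-- A commutative ring is Gorenstein if it is Noetherian and its localization at every
prime ideal has finite injective dimension over itself. -/
def IsGorensteinRing (R : Type u) [CommRing R] : Prop :=
  IsNoetherianRing R ∧ ∀ (P : Ideal R) [P.IsPrime],
    HasFiniteInjectiveDimension (Localization.AtPrime P)
      (ModuleCat.of (Localization.AtPrime P) (Localization.AtPrime P))

/-- The substitution action of a matrix on polynomials: `X i ↦ ∑ j, M i j • X j`. -/
def polyAct {F : Type u} [CommSemiring F] {m : ℕ} (M : Matrix (Fin m) (Fin m) F) :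
    MvPolynomial (Fin m) F →ₐ[F] MvPolynomial (Fin m) F :=
  MvPolynomial.aeval fun i => ∑ j, M i j • MvPolynomial.X j

/-- The subalgebra of polynomials invariant under a set of matrices. -/
def invariantAlg {F : Type u} [CommSemiring F] {m : ℕ} (S : Set (Matrix (Fin m) (Fin m) F)) :
    Subalgebra F (MvPolynomial (Fin m) F) where
  carrier := {f | ∀ M ∈ S, polyAct M f = f}
  mul_mem' := fun hf hg => fun M hM => by rw [_root_.map_mul, hf M hM, hg M hM]
  add_mem' := fun hf hg => fun M hM => by rw [_root_.map_add, hf M hM, hg M hM]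
  algebraMap_mem' := fun r => fun M hM => (polyAct M).commutes r

/-- The invariant ring `S(V)^G` for a subgroup `G` of `SL(m, F)`, where `S(V)` is realised
as the polynomial ring `F[X 0, …, X (m-1)]`. -/
def invariantRing {F : Type u} [Field F] {m : ℕ}
    (G : Subgroup (Matrix.SpecialLinearGroup (Fin m) F)) :
    Subalgebra F (MvPolynomial (Fin m) F) :=
  invariantAlg {M | ∃ g ∈ G, (g : Matrix (Fin m) (Fin m) F) = M}

/-- A matrix `M` is a transvection if `rank (M - 1) = 1` and `(M - 1)² = 0`. -/
def IsTransvectionMat {F : Type u} [Field F] {m : ℕ} (M : Matrix (Fin m) (Fin m) F) : Prop :=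
  (M - 1).rank = 1 ∧ (M - 1) * (M - 1) = 0

/-- `T(G)`: the subgroup generated by all transvections contained in `G`. -/
def transSubgroup {F : Type u} [Field F] {m : ℕ}
    (G : Subgroup (Matrix.SpecialLinearGroup (Fin m) F)) :
    Subgroup (Matrix.SpecialLinearGroup (Fin m) F) :=
  Subgroup.closure {g | g ∈ G ∧ IsTransvectionMat (g : Matrix (Fin m) (Fin m) F)}

section Homological

open Abelian in
lemma hasFiniteInjectiveDimension_of_le (R : Type u) [CommRing R] (M : ModuleCat.{u} R) (n : ℕ)
    [HasInjectiveDimensionLE M n] : HasFiniteInjectiveDimension R M := by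
  refine ⟨n, fun N i hi => ?_⟩
  obtain ⟨j, rfl⟩ : ∃ j, i = j + 1 := ⟨i - 1, by omega⟩
  let P : ProjectiveResolution N := ProjectiveResolution.of N
  have key : ∀ x : P.complex.X (j + 1) ⟶ M, P.complex.d (j + 2) (j + 1) ≫ x = 0 →
      ∃ g : P.complex.X j ⟶ M, P.complex.d (j + 1) j ≫ g = x := fun x hx => by
    have h0 : P.extMk x (j + 2) rfl hx = 0 :=
      Abelian.Ext.eq_zero_of_hasInjectiveDimensionLT _ (n + 1) (by omega)
    rwa [P.extMk_eq_zero_iff _ _ _ _ j rfl] at h0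
  have key' : ∀ y : P.complex.X j ⟶ M,
      P.complex.d (j + 2) (j + 1) ≫ P.complex.d (j + 1) j ≫ y = 0 := fun y => by simp
  have hz : Limits.IsZero (((Ext R (ModuleCat.{u} R) (j + 1)).obj (Opposite.op N)).obj M) := by
    refine Limits.IsZero.of_iso ?_ (P.isoExt (j + 1) M)
    rw [← HomologicalComplex.exactAt_iff_isZero_homology,
      HomologicalComplex.exactAt_iff' _ j (j + 1) (j + 2) (by simp) (by simp),
      ShortComplex.ShortExact.moduleCat_exact_iff_function_exact]
    intro x
    constructor
    · exact fun hx => key x hx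
    · rintro ⟨y, rfl⟩
      exact key' y
  exact ModuleCat.isZero_iff_subsingleton.mp hz

/-- An additive functor preserving short exact sequences and injective objects does not increase
the injective dimension. -/
lemma hasInjectiveDimensionLE_obj_of_preserves {A R : Type u} [CommRing A] [CommRing R]
    (F : ModuleCat.{u} A ⥤ ModuleCat.{u} R) [F.PreservesZeroMorphisms]
    (hF : ∀ T : ShortComplex (ModuleCat.{u} A), T.ShortExact → (T.map F).ShortExact)
    (hI : ∀ I : ModuleCat.{u} A, Injective I → Injective (F.obj I)) (n : ℕ)
    (M : ModuleCat.{u} A) [HasInjectiveDimensionLE M n] :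
    HasInjectiveDimensionLE (F.obj M) n := by
  induction n generalizing M with
  | zero =>
    have h : HasInjectiveDimensionLE M 0 := ‹_›
    simp only [HasInjectiveDimensionLE, zero_add, ← injective_iff_hasInjectiveDimensionLT_one]
      at h ⊢
    exact hI M h
  | succ n ih =>
    have ei : EnoughInjectives (ModuleCat.{u} A) := inferInstance
    rcases ei.1 M with ⟨I, inj, f, monof⟩
    let T := ShortComplex.mk f (Limits.cokernel.π f) (Limits.cokernel.condition f)
    have T_exact : T.ShortExact := { exact := ShortComplex.exact_cokernel f }
    let _ := (T_exact.hasInjectiveDimensionLT_X₃_iff n ‹_›).mpr ‹_›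
    have : Injective (T.map F).X₂ := hI _ inj
    exact ((hF T T_exact).hasInjectiveDimensionLT_X₃_iff n ‹_›).mp (ih T.X₃)

end Homological

section GlobalDimension

open TensorProduct

lemma shortExact_of_linearMap {R : Type u} [CommRing R] {M₁ M₂ M₃ : Type u} [AddCommGroup M₁]
    [AddCommGroup M₂] [AddCommGroup M₃] [Module R M₁] [Module R M₂] [Module R M₃]
    (f : M₁ →ₗ[R] M₂) (g : M₂ →ₗ[R] M₃) (hf : Function.Injective f) (hg : Function.Surjective g)
    (hfg : Function.Exact f g) :
    (ShortComplex.mk (ModuleCat.ofHom f) (ModuleCat.ofHom g)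
      (by ext x; exact (hfg (f x)).mpr ⟨x, rfl⟩)).ShortExact where
  exact := (ShortComplex.ShortExact.moduleCat_exact_iff_function_exact _).mpr hfg
  mono_f := (ModuleCat.mono_iff_injective _).mpr hf
  epi_g := (ModuleCat.epi_iff_surjective _).mpr hg

lemma hasProjectiveDimensionLE_baseChange {B A : Type u} [CommRing B] [CommRing A] [Algebra B A]
    [Module.Flat B A] (n : ℕ) (M : Type u) [AddCommGroup M] [Module B M]
    (h : HasProjectiveDimensionLE (ModuleCat.of B M) n) :
    HasProjectiveDimensionLE (ModuleCat.of A (A ⊗[B] M)) n := by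
  induction n generalizing M with
  | zero =>
    simp only [HasProjectiveDimensionLE, zero_add, ← projective_iff_hasProjectiveDimensionLT_one,
      ← IsProjective.iff_projective] at h ⊢
    infer_instance
  | succ n ih =>
    let p := Finsupp.linearCombination B (id : M → M)
    have hp : Function.Surjective p := Finsupp.linearCombination_id_surjective B M
    have hex : Function.Exact (LinearMap.ker p).subtype p := LinearMap.exact_subtype_ker_map p
    have S := shortExact_of_linearMap (M₁ := LinearMap.ker p) (LinearMap.ker p).subtype p
      (Submodule.injective_subtype _) hp hex
    have hexT : Function.Exact ((LinearMap.ker p).subtype.baseChange A) (p.baseChange A) := by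
      have := lTensor_exact (M := LinearMap.ker p) (N := M →₀ B) (P := M) A hex hp
      exact this
    have T := shortExact_of_linearMap (M₁ := A ⊗[B] LinearMap.ker p) ((LinearMap.ker p).subtype.baseChange A) (p.baseChange A)
      (Module.Flat.lTensor_preserves_injective_linearMap _ (Submodule.injective_subtype _))
      (LinearMap.lTensor_surjective _ hp) hexT
    have i1 : Projective (ModuleCat.of B (M →₀ B)) := by
      rw [← IsProjective.iff_projective]; infer_instance
    have i2 : Projective (ModuleCat.of A (A ⊗[B] (M →₀ B))) := by
      rw [← IsProjective.iff_projective]; infer_instance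
    have := (S.hasProjectiveDimensionLT_X₃_iff n i1).mp h
    exact (T.hasProjectiveDimensionLT_X₃_iff n i2).mpr (ih _ this)

open Polynomial in
lemma hasProjectiveDimensionLE_polynomial {B : Type u} [CommRing B] (n : ℕ)
    (h : ∀ M : ModuleCat.{u} B, HasProjectiveDimensionLE M n) (M : ModuleCat.{u} B[X]) :
    HasProjectiveDimensionLE M (n + 1) := by
  let _ : Module B M := Module.compHom M (Polynomial.C : B →+* B[X])
  have : IsScalarTower B B[X] M := IsScalarTower.of_algebraMap_smul fun r x => rfl
  let μ : M →ₗ[B] M := (LinearMap.lsmul B[X] M (Polynomial.X : B[X])).restrictScalars B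
  have hμ : ∀ m, μ m = (Polynomial.X : B[X]) • m := fun m => rfl
  let ψ : B[X] ⊗[B] M →ₗ[B[X]] M := LinearMap.liftBaseChange B[X] LinearMap.id
  let δ : B[X] ⊗[B] M →ₗ[B[X]] B[X] ⊗[B] M := (Polynomial.X : B[X]) • LinearMap.id - μ.baseChange B[X]
  have hψ : ∀ (p : B[X]) (m : M), ψ (p ⊗ₜ m) = p • m := fun p m => by simp [ψ]
  have hδ : ∀ (p : B[X]) (m : M), δ (p ⊗ₜ m) = (Polynomial.X * p) ⊗ₜ m - p ⊗ₜ[B] ((Polynomial.X : B[X]) • m) :=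
    fun p m => by simp [δ, hμ, TensorProduct.smul_tmul']
  have hψδ : ∀ t, ψ (δ t) = 0 := fun t => by
    induction t with
    | zero => simp
    | add x y hx hy => rw [map_add, map_add, hx, hy, add_zero]
    | tmul p m => rw [hδ, map_sub, hψ, hψ, mul_comm, mul_smul, sub_self]
  have hdec : ∀ t, ∃ s, t = 1 ⊗ₜ ψ t + δ s := fun t => by
    induction t with
    | zero => exact ⟨0, by simp⟩
    | add x y hx hy =>
      obtain ⟨s, hs⟩ := hx
      obtain ⟨s', hs'⟩ := hy
      refine ⟨s + s', ?_⟩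
      rw [map_add, map_add, TensorProduct.tmul_add]
      nth_rewrite 1 [hs, hs']
      abel
    | tmul p m =>
      induction p using Polynomial.induction_on' generalizing m with
      | add p q hp hq =>
        obtain ⟨s, hs⟩ := hp m
        obtain ⟨s', hs'⟩ := hq m
        refine ⟨s + s', ?_⟩
        rw [TensorProduct.add_tmul, map_add, map_add, TensorProduct.tmul_add]
        nth_rewrite 1 [hs, hs']
        abel
      | monomial k a =>
        induction k generalizing m with
        | zero =>
          refine ⟨0, ?_⟩
          have : (monomial 0 a : B[X]) = a • 1 := by rw [Polynomial.smul_eq_C_mul, mul_one]; rfl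
          rw [this, hψ, map_zero, add_zero, TensorProduct.smul_tmul, smul_assoc, one_smul]
        | succ k ih =>
          obtain ⟨s, hs⟩ := ih ((Polynomial.X : B[X]) • m)
          refine ⟨s + monomial k a ⊗ₜ m, ?_⟩
          have e : Polynomial.X * monomial k a = (monomial (k + 1) a : B[X]) := X_mul_monomial k a
          rw [map_add, hδ, e, hψ]
          rw [hψ, smul_smul, mul_comm, e] at hs
          rw [hs]
          abel
  have hinj : Function.Injective δ := by
    rw [injective_iff_map_eq_zero]
    intro t ht
    let e := PolynomialModule.polynomialTensorProductLEquivPolynomialModule B M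
    have he : ∀ t n, (e (δ t)).coeff (n + 1) = (e t).coeff n - (Polynomial.X : B[X]) • (e t).coeff (n + 1) := by
      intro t n
      induction t with
      | zero => simp
      | add x y hx hy => 
        simp only [map_add, PolynomialModule.coeff_add, Finsupp.add_apply, hx, hy, smul_add]
        abel
      | tmul p m =>
        have e' : ∀ (p : B[X]) (m : M), e (p ⊗ₜ m) = p • PolynomialModule.single B 0 m :=
          fun p m => LinearMap.liftBaseChange_tmul ..
        have hs : ∀ (x y : PolynomialModule B M) (k : ℕ),
            (x - y).coeff k = x.coeff k - y.coeff k := fun x y k => rfl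
        rw [hδ, map_sub, hs, e', e', e', PolynomialModule.smul_single_apply,
          PolynomialModule.smul_single_apply, PolynomialModule.smul_single_apply]
        simp only [Nat.zero_le, if_true, Nat.sub_zero, Polynomial.coeff_X_mul]
        rw [PolynomialModule.smul_single_apply, if_pos (Nat.zero_le _), Nat.sub_zero, smul_comm]
    have h1 : ∀ k n, (e t).coeff n = (Polynomial.X : B[X]) ^ k • (e t).coeff (n + k) := by
      intro k n
      induction k with
      | zero => simp
      | succ k ih =>
        have := he t (n + k)
        rw [ht, map_zero] at this
        rw [ih, pow_succ, mul_smul, sub_eq_zero.mp this.symm, add_assoc]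
    apply e.injective
    rw [map_zero]
    ext n
    have : (e t).coeff (n + ((e t).coeff.support.sup id + 1)) = 0 := by
      by_contra hne
      have := Finset.le_sup (f := id) (Finsupp.mem_support_iff.mpr hne)
      simp only [id] at this
      omega
    rw [h1 _ n, this, smul_zero]; rfl
  have S := shortExact_of_linearMap δ ψ hinj (fun m => ⟨1 ⊗ₜ m, by rw [hψ, one_smul]⟩) (by
    intro t
    constructor
    · intro ht
      obtain ⟨s, hs⟩ := hdec t
      exact ⟨s, by rw [hs, ht]; simp⟩
    · rintro ⟨s, rfl⟩
      exact hψδ s)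
  have h1 := hasProjectiveDimensionLE_baseChange (A := B[X]) n M (h _)
  exact S.hasProjectiveDimensionLT_X₃ (n + 1) h1
    (hasProjectiveDimensionLT_of_ge _ (n + 1) _ (by omega))

end GlobalDimension

section GlobalDimensionMvPolynomial

lemma hasProjectiveDimensionLE_of_ringEquiv {A B : Type u} [CommRing A] [CommRing B] (e : A ≃+* B)
    (n : ℕ) (h : ∀ M : ModuleCat.{u} A, HasProjectiveDimensionLE M n) (M : ModuleCat.{u} B) :
    HasProjectiveDimensionLE M n := by
  let N : ModuleCat.{u} A := (ModuleCat.restrictScalars (e : A →+* B)).obj M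
  have := h N
  let _ := RingHomInvPair.of_ringEquiv e
  let _ := RingHomInvPair.of_ringEquiv e.symm
  let e' : N ≃ₛₗ[RingHomClass.toRingHom e] M :=
    { toFun := fun x => x
      invFun := fun x => x
      map_add' := fun _ _ => rfl
      map_smul' := fun _ _ => rfl
      left_inv := fun _ => rfl
      right_inv := fun _ => rfl }
  exact ModuleCat.hasProjectiveDimensionLE_of_semiLinearEquiv e e' n

lemma hasProjectiveDimensionLE_mvPolynomial (F : Type u) [Field F] (n : ℕ)
    (M : ModuleCat.{u} (MvPolynomial (Fin n) F)) : HasProjectiveDimensionLE M n := by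
  induction n with
  | zero =>
    refine hasProjectiveDimensionLE_of_ringEquiv
      (MvPolynomial.isEmptyAlgEquiv F (Fin 0)).symm.toRingEquiv 0 (fun N => ?_) M
    have : Projective N := by
      rw [← IsProjective.iff_projective]
      exact Module.Projective.of_free
    simpa only [HasProjectiveDimensionLE, zero_add, ← projective_iff_hasProjectiveDimensionLT_one]
  | succ n ih =>
    exact hasProjectiveDimensionLE_of_ringEquiv (MvPolynomial.finSuccEquiv F n).symm.toRingEquiv _
      (hasProjectiveDimensionLE_polynomial n ih) M

lemma hasInjectiveDimensionLE_of_forall_hasProjectiveDimensionLE {A : Type u} [CommRing A] (n : ℕ)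
    (h : ∀ M : ModuleCat.{u} A, HasProjectiveDimensionLE M n) (M : ModuleCat.{u} A) :
    HasInjectiveDimensionLE M n :=
  HasInjectiveDimensionLT.mk fun _ hi Y e => by
    have := h Y
    exact e.eq_zero_of_hasProjectiveDimensionLT (n + 1) hi

end GlobalDimensionMvPolynomial

section Frobenius

/-- A ring homomorphism `f : A → R` is a Frobenius extension with Frobenius form `Φ : R → A` if
`Φ` is `A`-linear and admits a pair of dual bases. -/
def IsFrob {A R : Type*} [CommRing A] [CommRing R] (f : A →+* R) (Φ : R →+ A) : Prop :=
  (∀ a x, Φ (f a * x) = a * Φ x) ∧ ∃ (ι : Type) (_ : Fintype ι) (b b' : ι → R),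
    ∀ x, x = ∑ i, f (Φ (x * b i)) * b' i

variable {A R : Type u} [CommRing A] [CommRing R] {f : A →+* R} {Φ : R →+ A}

lemma IsFrob.exists_lift (h : IsFrob f Φ) {M N : ModuleCat.{u} A} (π : M ⟶ N)
    (g : (ModuleCat.coextendScalars f).obj N) (hg : ∀ x : R, ∃ m, π.hom m = g x) :
    ∃ g' : (ModuleCat.coextendScalars f).obj M, (ModuleCat.coextendScalars f).map π g' = g := by
  obtain ⟨hΦ, ι, _, b, b', hb⟩ := h
  choose m hm using fun i => hg (b' i)
  let g₀ : R →+ N := (ModuleCat.CoextendScalars.equiv f N g).toAddMonoidHom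
  have gl : ∀ (a : A) (x : R), g₀ (f a * x) = a • g₀ x := fun a x =>
    (ModuleCat.CoextendScalars.equiv f N g).map_smul a x
  let g' : (ModuleCat.restrictScalars f).obj (ModuleCat.of R R) →ₗ[A] M :=
    { toFun := fun x : R => ∑ i, Φ (x * b i) • m i
      map_add' := fun x y : R => by
        change ∑ i, Φ ((x + y) * b i) • m i = ∑ i, Φ (x * b i) • m i + ∑ i, Φ (y * b i) • m i
        simp [add_mul, add_smul, Finset.sum_add_distrib]
      map_smul' := fun a (x : R) => by
        change ∑ i, Φ (f a * x * b i) • m i = a • ∑ i, Φ (x * b i) • m i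
        simp [mul_assoc, hΦ, Finset.smul_sum, mul_smul] }
  refine ⟨(ModuleCat.CoextendScalars.equiv f M).symm g', ?_⟩
  refine ModuleCat.CoextendScalars.ext (LinearMap.ext fun x : R => ?_)
  change π.hom (∑ i, Φ (x * b i) • m i) = g₀ x
  conv_rhs => rw [hb x]
  rw [map_sum, map_sum]
  exact Finset.sum_congr rfl fun i _ => by rw [gl, map_smul, hm]; rfl

lemma IsFrob.shortExact_coextendScalars (h : IsFrob f Φ) (T : ShortComplex (ModuleCat.{u} A))
    (hT : T.ShortExact) [(ModuleCat.coextendScalars.{u, u, u} f).PreservesZeroMorphisms] :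
    (T.map (ModuleCat.coextendScalars f)).ShortExact where
  exact := by
    rw [ShortComplex.ShortExact.moduleCat_exact_iff_function_exact]
    have he := (ShortComplex.ShortExact.moduleCat_exact_iff_function_exact T).mp hT.exact
    intro g
    constructor
    · intro hg
      refine h.exists_lift T.f g fun x => (he _).mp ?_
      exact congrArg (fun k : (ModuleCat.coextendScalars f).obj T.X₃ => k x) hg
    · rintro ⟨g', rfl⟩
      exact ModuleCat.CoextendScalars.ext (LinearMap.ext fun x : R => (he _).mpr
        ⟨ModuleCat.CoextendScalars.equiv f T.X₁ g' x, rfl⟩)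
  mono_f := by
    have := hT.mono_f
    have := (ModuleCat.mono_iff_injective _).mp hT.mono_f
    refine (ModuleCat.mono_iff_injective _).mpr fun g g' hg => ?_
    refine ModuleCat.CoextendScalars.ext (LinearMap.ext fun x : R => this ?_)
    exact congrArg (fun k : (ModuleCat.coextendScalars f).obj T.X₂ => k x) hg
  epi_g := by
    have := (ModuleCat.epi_iff_surjective _).mp hT.epi_g
    exact (ModuleCat.epi_iff_surjective _).mpr fun g => h.exists_lift T.g g fun x => this _

lemma IsFrob.injective_apply_mul (h : IsFrob f Φ) {s s' : R} (hs : ∀ x, Φ (s * x) = Φ (s' * x)) :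
    s = s' := by
  obtain ⟨-, ι, _, b, b', hb⟩ := h
  rw [hb s, hb s']
  exact Finset.sum_congr rfl fun i _ => by rw [hs]

lemma IsFrob.exists_eq_apply_mul (h : IsFrob f Φ) (g : R →+ A)
    (hg : ∀ a x, g (f a * x) = a * g x) : ∃ s, ∀ x, g x = Φ (s * x) := by
  obtain ⟨hΦ, ι, _, b, b', hb⟩ := h
  refine ⟨∑ i, f (g (b' i)) * b i, fun x => ?_⟩
  conv_lhs => rw [hb x]
  rw [Finset.sum_mul, map_sum, map_sum]
  refine Finset.sum_congr rfl fun i _ => ?_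
  rw [hg, mul_assoc, hΦ, mul_comm, mul_comm x]

lemma IsFrob.hasInjectiveDimensionLE (h : IsFrob f Φ) (n : ℕ)
    [HasInjectiveDimensionLE (ModuleCat.of A A) n] :
    HasInjectiveDimensionLE (ModuleCat.of R R) n := by
  have : (ModuleCat.coextendScalars.{u, u, u} f).IsRightAdjoint :=
    (ModuleCat.restrictCoextendScalarsAdj f).isRightAdjoint
  have : (ModuleCat.coextendScalars.{u, u, u} f).PreservesZeroMorphisms :=
    Functor.preservesZeroMorphisms_of_isRightAdjoint _
  have h1 := hasInjectiveDimensionLE_obj_of_preserves (ModuleCat.coextendScalars f)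
    (fun T hT => h.shortExact_coextendScalars T hT)
    (fun I _ => Injective.injective_of_adjoint (ModuleCat.restrictCoextendScalarsAdj f) I)
    n (ModuleCat.of A A)
  let θ (s : R) : (ModuleCat.restrictScalars f).obj (ModuleCat.of R R) →ₗ[A] A :=
    { toFun := fun x : R => Φ (s * x)
      map_add' := fun x y : R => by
        change Φ (s * (x + y)) = Φ (s * x) + Φ (s * y)
        rw [mul_add, map_add]
      map_smul' := fun a (x : R) => by
        change Φ (s * (f a * x)) = a * Φ (s * x)
        rw [mul_left_comm, h.1] }
  let Θ : R →ₗ[R] (ModuleCat.coextendScalars f).obj (ModuleCat.of A A) :=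
    { toFun := fun s => (ModuleCat.CoextendScalars.equiv f (ModuleCat.of A A)).symm (θ s)
      map_add' := fun x y => ModuleCat.CoextendScalars.ext <| LinearMap.ext fun t : R => by
        change Φ ((x + y) * t) = Φ (x * t) + Φ (y * t)
        rw [add_mul, map_add]
      map_smul' := fun r x => ModuleCat.CoextendScalars.ext <| LinearMap.ext fun t : R => by
        change Φ ((r * x) * t) = Φ (x * (t * r))
        congr 1; ring }
  refine (ModuleCat.hasInjectiveDimensionLE_iff_of_linearEquiv
    (LinearEquiv.ofBijective Θ ⟨fun s s' hs => ?_, fun g => ?_⟩) n).mpr h1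
  · exact h.injective_apply_mul fun x =>
      congrArg (fun k : (ModuleCat.coextendScalars f).obj (ModuleCat.of A A) => k x) hs
  · let g' : R →+ A := (ModuleCat.CoextendScalars.equiv f (ModuleCat.of A A) g).toAddMonoidHom
    obtain ⟨s, hs⟩ := h.exists_eq_apply_mul g' fun a x =>
      (ModuleCat.CoextendScalars.equiv f (ModuleCat.of A A) g).map_smul a x
    exact ⟨s, ModuleCat.CoextendScalars.ext <| LinearMap.ext fun t : R => (hs t).symm⟩

lemma isGorensteinRing_of_hasInjectiveDimensionLE (hR : IsNoetherianRing R) (n : ℕ)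
    [HasInjectiveDimensionLE (ModuleCat.of R R) n] : IsGorensteinRing R := by
  refine ⟨hR, fun P _ => ?_⟩
  have h1 := ModuleCat.localizedModule_hasInjectiveDimensionLE n P.primeCompl (ModuleCat.of R R)
  let e : LocalizedModule P.primeCompl R ≃ₗ[Localization.AtPrime P] Localization.AtPrime P :=
    (IsLocalizedModule.iso P.primeCompl
      (Algebra.linearMap R (Localization.AtPrime P))).extendScalarsOfIsLocalization P.primeCompl _
  let e' : (ModuleCat.of R R).localizedModule P.primeCompl ≃ₗ[Localization.AtPrime P]
      Localization.AtPrime P := (Shrink.linearEquiv (Localization.AtPrime P) _).trans e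
  have := (ModuleCat.hasInjectiveDimensionLE_iff_of_linearEquiv
    (N := ModuleCat.of _ (Localization.AtPrime P)) e' n).mp h1
  exact hasFiniteInjectiveDimension_of_le _ _ n

lemma IsFrob.isNoetherianRing [IsNoetherianRing A] (h : IsFrob f Φ) : IsNoetherianRing R := by
  obtain ⟨-, ι, _, b, b', hb⟩ := h
  let _ := f.toAlgebra
  have : Module.Finite A R := by
    refine Module.Finite.of_surjective (Fintype.linearCombination A b') fun x => ?_
    exact ⟨fun i => Φ (x * b i), by
      conv_rhs => rw [hb x]
      simp [Fintype.linearCombination_apply, Algebra.smul_def, RingHom.algebraMap_toAlgebra]⟩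
  exact IsNoetherianRing.of_finite A R

/-- A Frobenius extension of a polynomial ring over a field is Gorenstein. -/
theorem IsFrob.isGorensteinRing {F : Type u} [Field F] {m : ℕ}
    {f : MvPolynomial (Fin m) F →+* R} {Φ : R →+ MvPolynomial (Fin m) F} (h : IsFrob f Φ) :
    IsGorensteinRing R := by
  have := hasInjectiveDimensionLE_of_forall_hasProjectiveDimensionLE m
    (hasProjectiveDimensionLE_mvPolynomial F m) (ModuleCat.of _ (MvPolynomial (Fin m) F))
  have := h.hasInjectiveDimensionLE m
  exact isGorensteinRing_of_hasInjectiveDimensionLE h.isNoetherianRing m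

end Frobenius

section FrobeniusConstructions

variable {A R T : Type*} [CommRing A] [CommRing R] [CommRing T]

lemma IsFrob.comp {f : A →+* R} {Φ : R →+ A} {g : R →+* T} {Ψ : T →+ R} (hf : IsFrob f Φ)
    (hg : IsFrob g Ψ) : IsFrob (g.comp f) (Φ.comp Ψ) := by
  obtain ⟨hΦ, ι, _, b, b', hb⟩ := hf
  obtain ⟨hΨ, κ, _, c, c', hc⟩ := hg
  refine ⟨fun a x => by simp [hΨ, hΦ], ι × κ, inferInstance, fun i => g (b i.1) * c i.2,
    fun i => g (b' i.1) * c' i.2, fun x => ?_⟩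
  rw [Fintype.sum_prod_type_right]
  conv_lhs => rw [hc x]
  refine Finset.sum_congr rfl fun j _ => ?_
  conv_lhs => rw [hb (Ψ (x * c j)), map_sum, Finset.sum_mul]
  refine Finset.sum_congr rfl fun i _ => ?_
  have : x * (g (b i) * c j) = g (b i) * (x * c j) := by ring
  simp only [RingHom.comp_apply, AddMonoidHom.comp_apply, this, hΨ, map_mul, mul_comm (b i),
    mul_assoc]

lemma IsFrob.of_ringEquiv (e : A ≃+* R) :
    IsFrob (e : A →+* R) (e.symm : R →+* A).toAddMonoidHom :=
  ⟨fun a x => by simp, Unit, inferInstance, fun _ => 1, fun _ => 1, fun x => by simp⟩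

/-- Descent of a Frobenius extension along a Reynolds operator. -/
lemma IsFrob.codRestrict {k : Type*} [CommRing k] [Algebra k R] {f : A →+* R} {Φ : R →+ A}
    (h : IsFrob f Φ) (B : Subalgebra k R) (hfB : ∀ a, f a ∈ B) (ρ : R →+ R) (hρB : ∀ x, ρ x ∈ B)
    (hρ : ∀ x ∈ B, ρ x = x) (hρl : ∀ x ∈ B, ∀ y, ρ (x * y) = x * ρ y)
    (hρΦ : ∀ x, Φ (ρ x) = Φ x) :
    IsFrob (f.codRestrict B hfB) (Φ.comp B.val.toRingHom.toAddMonoidHom) := by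
  obtain ⟨hΦ, ι, _, b, b', hb⟩ := h
  refine ⟨fun a x => hΦ a x, ι, inferInstance, fun i => ⟨ρ (b i), hρB _⟩,
    fun i => ⟨ρ (b' i), hρB _⟩, fun x => Subtype.ext ?_⟩
  rw [AddSubmonoidClass.coe_finsetSum]
  change (x : R) = ∑ i, f (Φ (x * ρ (b i))) * ρ (b' i)
  conv_lhs => rw [← hρ x x.2, hb x, map_sum]
  refine Finset.sum_congr rfl fun i _ => ?_
  rw [hρl _ (hfB _), ← hρΦ, hρl _ x.2]

section Monic

open Polynomial

lemma modByMonic_X_mul [Nontrivial A] {G : A[X]} (hG : G.Monic) {m : A[X]}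
    (hm : m.degree < G.degree) :
    (Polynomial.X * m) %ₘ G =
      Polynomial.X * m - Polynomial.C (m.coeff (G.natDegree - 1)) * G := by
  refine (Polynomial.div_modByMonic_unique (Polynomial.C (m.coeff (G.natDegree - 1))) _ hG
    ⟨by ring, ?_⟩).2
  rw [Polynomial.degree_eq_natDegree hG.ne_zero, Polynomial.degree_lt_iff_coeff_zero] at hm ⊢
  intro j hj
  have h0 : 0 < G.natDegree ∨ G.natDegree = 0 := by omega
  rcases h0 with h0 | h0
  · obtain ⟨i, rfl⟩ : ∃ i, j = i + 1 := ⟨j - 1, by omega⟩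
    rw [Polynomial.coeff_sub, Polynomial.coeff_X_mul, Polynomial.coeff_C_mul]
    rcases eq_or_lt_of_le hj with h | h
    · have : G.natDegree - 1 = i := by omega
      rw [this, ← h, hG.coeff_natDegree, mul_one, sub_self]
    · rw [hm i (by omega), Polynomial.coeff_eq_zero_of_natDegree_lt h, mul_zero, sub_zero]
  · have : m = 0 := Polynomial.ext fun i => by rw [hm i (by omega), Polynomial.coeff_zero]
    simp [this]

/-- The coefficient of `X ^ i` in the reduced representative of an element of `A[X]/(G)`. -/
def adjoinRootCoeff {G : A[X]} (hG : G.Monic) (i : ℕ) : AdjoinRoot G →ₗ[A] A :=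
  Polynomial.lcoeff A i ∘ₗ AdjoinRoot.modByMonicHom hG

lemma adjoinRootCoeff_root_mul [Nontrivial A] {G : A[X]} (hG : G.Monic) (i : ℕ)
    (x : AdjoinRoot G) :
    adjoinRootCoeff hG i x = adjoinRootCoeff hG (i + 1) (AdjoinRoot.root G * x) +
      G.coeff (i + 1) * adjoinRootCoeff hG (G.natDegree - 1) x := by
  obtain ⟨m, rfl⟩ := AdjoinRoot.mk_surjective x
  have hm : m %ₘ G = AdjoinRoot.modByMonicHom hG (AdjoinRoot.mk G m) := by simp
  have h1 : AdjoinRoot.mk G m = AdjoinRoot.mk G (m %ₘ G) := by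
    rw [hm, AdjoinRoot.mk_leftInverse hG]
  have h2 : AdjoinRoot.root G * AdjoinRoot.mk G m = AdjoinRoot.mk G (Polynomial.X * (m %ₘ G)) := by
    rw [h1, map_mul, AdjoinRoot.mk_X]
  simp only [adjoinRootCoeff, LinearMap.comp_apply, h2, AdjoinRoot.modByMonicHom_mk,
    modByMonic_X_mul hG (degree_modByMonic_lt m hG), Polynomial.lcoeff_apply]
  rw [Polynomial.coeff_sub, Polynomial.coeff_X_mul, Polynomial.coeff_C_mul]
  ring

lemma isFrob_adjoinRoot [Nontrivial A] {G : A[X]} (hG : G.Monic) :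
    IsFrob (algebraMap A (AdjoinRoot G))
      (adjoinRootCoeff hG (G.natDegree - 1)).toAddMonoidHom := by
  refine ⟨fun a x => by rw [← Algebra.smul_def]; exact (adjoinRootCoeff hG _).map_smul _ _, Fin G.natDegree, inferInstance, ?_⟩
  have key : ∀ j, j < G.natDegree → ∃ b, ∀ x, adjoinRootCoeff hG (G.natDegree - 1 - j) x =
      adjoinRootCoeff hG (G.natDegree - 1) (x * b) := by
    intro j
    induction j with
    | zero => exact fun _ => ⟨1, fun x => by simp⟩
    | succ j ih =>
      intro hj
      obtain ⟨b, hb⟩ := ih (by omega)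
      refine ⟨AdjoinRoot.root G * b + algebraMap _ _ (G.coeff (G.natDegree - 1 - j)), fun x => ?_⟩
      have hi : G.natDegree - 1 - (j + 1) + 1 = G.natDegree - 1 - j := by omega
      rw [adjoinRootCoeff_root_mul, hi, hb, mul_add, map_add, mul_comm x (algebraMap _ _ _),
        ← Algebra.smul_def, map_smul, smul_eq_mul]
      congr 2; ring
  have key' : ∀ i : Fin G.natDegree, ∃ b, ∀ x, adjoinRootCoeff hG i x =
      adjoinRootCoeff hG (G.natDegree - 1) (x * b) := fun i => by
    have := key (G.natDegree - 1 - i) (by omega)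
    rwa [show G.natDegree - 1 - (G.natDegree - 1 - i) = (i : ℕ) by omega] at this
  choose b hb using key'
  refine ⟨b, fun i => AdjoinRoot.root G ^ (i : ℕ), fun x => ?_⟩
  have h1 : ∀ i : Fin G.natDegree, (adjoinRootCoeff hG (G.natDegree - 1)).toAddMonoidHom (x * b i)
      = (AdjoinRoot.modByMonicHom hG x).coeff i := fun i => (hb i x).symm
  simp only [h1]
  conv_lhs => rw [← AdjoinRoot.mk_leftInverse hG x]
  have hd : (AdjoinRoot.modByMonicHom hG x).degree < G.natDegree := by
    obtain ⟨m, rfl⟩ := AdjoinRoot.mk_surjective x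
    rw [AdjoinRoot.modByMonicHom_mk, ← degree_eq_natDegree hG.ne_zero]
    exact degree_modByMonic_lt m hG
  have hsum : AdjoinRoot.modByMonicHom hG x = ∑ i : Fin G.natDegree,
      Polynomial.monomial i ((AdjoinRoot.modByMonicHom hG x).coeff i) :=
    ((Polynomial.sum_fin (fun i c => Polynomial.monomial i c) (by simp) hd).trans
      (Polynomial.sum_monomial_eq _)).symm
  refine (congrArg (AdjoinRoot.mk G) hsum).trans ?_
  rw [map_sum]
  refine Finset.sum_congr rfl fun i _ => ?_
  rw [← Polynomial.C_mul_X_pow_eq_monomial, map_mul, map_pow, AdjoinRoot.mk_X, AdjoinRoot.mk_C]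
  rfl

lemma adjoinRootCoeff_root_pow [Nontrivial A] {G : A[X]} (hG : G.Monic) (h0 : 0 < G.natDegree) :
    adjoinRootCoeff hG (G.natDegree - 1) (AdjoinRoot.root G ^ (G.natDegree - 1)) = 1 := by
  rw [← AdjoinRoot.mk_X, ← map_pow, adjoinRootCoeff, LinearMap.comp_apply,
    AdjoinRoot.modByMonicHom_mk, (Polynomial.modByMonic_eq_self_iff hG).mpr]
  · simp
  · rw [degree_X_pow, degree_eq_natDegree hG.ne_zero]
    exact_mod_cast (by omega : G.natDegree - 1 < G.natDegree)

/-- `B[X]` is obtained from its subring `B[g]` by adjoining a root of `g(Y) - g`. -/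
def adjoinRootEquivComp (g : A[X]) :
    AdjoinRoot (g.map (Polynomial.C : A →+* A[X]) - Polynomial.C Polynomial.X) ≃+* A[X] :=
  RingEquiv.ofRingHom
    (AdjoinRoot.lift (Polynomial.compRingHom g) Polynomial.X (by
      rw [Polynomial.eval₂_sub, Polynomial.eval₂_map, Polynomial.eval₂_C]
      have : (compRingHom g).comp Polynomial.C = Polynomial.C := by ext; simp
      rw [this]
      simp))
    (eval₂RingHom ((AdjoinRoot.of _).comp Polynomial.C) (AdjoinRoot.root _))
    (by ext <;> simp)
    (by
      refine AdjoinRoot.ringHom_ext ?_ ?_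
      · ext a
        · simp
        · have := AdjoinRoot.eval₂_root (g.map (Polynomial.C : A →+* A[X]) - Polynomial.C Polynomial.X)
          rw [Polynomial.eval₂_sub, Polynomial.eval₂_map, Polynomial.eval₂_C, sub_eq_zero] at this
          simpa using this
      · simp)

lemma adjoinRootEquivComp_of (g q : A[X]) :
    adjoinRootEquivComp g (AdjoinRoot.of _ q) = compRingHom g q := by
  simp only [adjoinRootEquivComp, RingEquiv.ofRingHom_apply]
  exact AdjoinRoot.lift_of _

/-- If `g` is monic of positive degree, then `B[g] ⊆ B[X]` is a Frobenius extension. -/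
lemma exists_isFrob_compRingHom [Nontrivial A] {g : A[X]} (hg : g.Monic) (h0 : 0 < g.natDegree) :
    ∃ Φ, IsFrob (compRingHom g) Φ ∧ Φ (Polynomial.X ^ (g.natDegree - 1)) = 1 := by
  let G := g.map (Polynomial.C : A →+* A[X]) - Polynomial.C Polynomial.X
  have hd : (Polynomial.C (Polynomial.X : A[X])).degree <
      (g.map (Polynomial.C : A →+* A[X])).degree := by
    rw [hg.degree_map, degree_C Polynomial.X_ne_zero, degree_eq_natDegree hg.ne_zero]
    exact_mod_cast h0
  have hG : G.Monic := (hg.map _).sub_of_left hd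
  have hn : G.natDegree = g.natDegree := by
    rw [Polynomial.natDegree_sub_eq_left_of_natDegree_lt, hg.natDegree_map]
    rw [hg.natDegree_map, natDegree_C]
    exact h0
  have h1 := (isFrob_adjoinRoot hG).comp (IsFrob.of_ringEquiv (adjoinRootEquivComp g))
  refine ⟨(adjoinRootCoeff hG (G.natDegree - 1)).toAddMonoidHom.comp
    ((adjoinRootEquivComp g).symm : A[X] →+* AdjoinRoot G).toAddMonoidHom, ?_, ?_⟩
  · convert h1 using 1
    exact RingHom.ext fun q => (adjoinRootEquivComp_of g q).symm
  · have h2 : (adjoinRootEquivComp g).symm (Polynomial.X ^ (g.natDegree - 1)) =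
        AdjoinRoot.root G ^ (G.natDegree - 1) := by
      rw [hn, map_pow]
      simp [adjoinRootEquivComp, G]
    have h3 := adjoinRootCoeff_root_pow hG (hn ▸ h0)
    rw [← h2] at h3
    exact h3

end Monic

end FrobeniusConstructions

section FrobeniusEndomorphisms

variable {k : Type u} [Field k]

/-- `f` is a Frobenius extension whose Frobenius form maps `t` to `1`. -/
def IsFrobSplit {S : Type*} [CommRing S] [Algebra k S] (f : S →ₐ[k] S) (t : S) : Prop :=
  ∃ Φ : S →+ S, IsFrob (f : S →+* S) Φ ∧ Φ t = 1

lemma IsFrobSplit.comp {S : Type*} [CommRing S] [Algebra k S] {f g : S →ₐ[k] S} {s t : S}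
    (hf : IsFrobSplit f s) (hg : IsFrobSplit g t) : IsFrobSplit (g.comp f) (g s * t) := by
  obtain ⟨Φ, hΦ, hs⟩ := hf
  obtain ⟨Ψ, hΨ, ht⟩ := hg
  refine ⟨Φ.comp Ψ, hΦ.comp hΨ, ?_⟩
  have := hΨ.1 s t
  rw [AddMonoidHom.comp_apply]
  exact (congrArg Φ (this.trans (by rw [ht, mul_one]))).trans hs

lemma isFrobSplit_of_algEquiv {B : Type u} [CommRing B] [Nontrivial B] [Algebra k B] {σ : Type*}
    (e : MvPolynomial σ k ≃ₐ[k] Polynomial B) (i : σ) (hi : e (X i) = Polynomial.X)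
    (hj : ∀ j ≠ i, ∃ b, e (X j) = Polynomial.C b) (φ : MvPolynomial σ k →ₐ[k] MvPolynomial σ k)
    (hφ : ∀ j ≠ i, φ (X j) = X j) {n : ℕ} (q : Polynomial B)
    (hq : q.degree < ((n + 1 : ℕ) : WithBot ℕ)) (hF : e (φ (X i)) = Polynomial.X ^ (n + 1) + q) :
    IsFrobSplit φ (X i ^ n) := by
  have hn : (Polynomial.X ^ (n + 1) + q).natDegree = n + 1 := by
    rw [Polynomial.natDegree_add_eq_left_of_degree_lt, Polynomial.natDegree_X_pow]
    rwa [Polynomial.degree_X_pow]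
  obtain ⟨Φ, hΦ, ht⟩ := exists_isFrob_compRingHom (Polynomial.monic_X_pow_add hq)
    (by rw [hn]; omega)
  have h := ((IsFrob.of_ringEquiv e.toRingEquiv).comp hΦ).comp
    (IsFrob.of_ringEquiv e.symm.toRingEquiv)
  refine ⟨(((e.toRingEquiv.symm : Polynomial B →+* _).toAddMonoidHom.comp Φ).comp
    ((e.symm.toRingEquiv.symm : _ →+* Polynomial B).toAddMonoidHom)), ?_, ?_⟩
  · convert h using 1
    refine MvPolynomial.ringHom_ext (fun r => ?_) fun j => ?_
    · have h1 : e (MvPolynomial.C r) = Polynomial.C (algebraMap k B r) := e.commutes r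
      have h2 : e.symm (Polynomial.C (algebraMap k B r)) = MvPolynomial.C r := e.symm.commutes r
      simp [h1, h2, algHom_C]
    · by_cases hji : j = i
      · subst hji
        simp [hi, ← hF]
      · obtain ⟨b, hb⟩ := hj j hji
        simp [hφ j hji, hb]
        rw [← hb, e.symm_apply_apply]
  · rw [hn, Nat.add_sub_cancel] at ht
    have : e (X i ^ n) = Polynomial.X ^ n := by rw [map_pow, hi]
    change e.symm (Φ (e (X i ^ n))) = 1
    rw [this, ht, map_one]

/-- The polynomial ring viewed as a polynomial ring in the `i`-th variable. -/
def splitVariable (k : Type u) [Field k] {m : ℕ} (i : Fin (m + 1)) :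
    MvPolynomial (Fin (m + 1)) k ≃ₐ[k] Polynomial (MvPolynomial (Fin m) k) :=
  (renameEquiv k (Equiv.swap 0 i)).trans (finSuccEquiv k m)

lemma splitVariable_X_self {m : ℕ} (i : Fin (m + 1)) :
    splitVariable k i (X i) = Polynomial.X := by
  simp [splitVariable, finSuccEquiv_X_zero]

lemma exists_splitVariable_X {m : ℕ} (i j : Fin (m + 1)) (hj : j ≠ i) :
    ∃ l, splitVariable k i (X j) = Polynomial.C (X l) := by
  have : Equiv.swap 0 i j ≠ 0 := by
    intro h
    exact hj ((Equiv.injective _) (h.trans (Equiv.swap_apply_right 0 i).symm))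
  obtain ⟨l, hl⟩ := Fin.exists_succ_eq.mpr this
  exact ⟨l, by simp [splitVariable, ← hl, finSuccEquiv_X_succ]⟩

lemma isFrobSplit_of_variable {m : ℕ} (i : Fin (m + 1))
    (φ : MvPolynomial (Fin (m + 1)) k →ₐ[k] MvPolynomial (Fin (m + 1)) k)
    (hφ : ∀ j ≠ i, φ (X j) = X j) {n : ℕ} (q : Polynomial (MvPolynomial (Fin m) k))
    (hq : q.degree < ((n + 1 : ℕ) : WithBot ℕ))
    (hF : splitVariable k i (φ (X i)) = Polynomial.X ^ (n + 1) + q) :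
    IsFrobSplit φ (X i ^ n) :=
  isFrobSplit_of_algEquiv (splitVariable k i) i (splitVariable_X_self i)
    (fun j hj => (exists_splitVariable_X i j hj).imp' _ fun _ h => h) φ hφ q hq hF

lemma isFrobSplit_pow {m : ℕ} (i : Fin (m + 1)) (n : ℕ) :
    IsFrobSplit (aeval (Function.update X i (X i ^ (n + 1))) :
      MvPolynomial (Fin (m + 1)) k →ₐ[k] MvPolynomial (Fin (m + 1)) k) (X i ^ n) := by
  refine isFrobSplit_of_variable i _ (fun j hj => by simp [hj]) 0 ?_ ?_
  · simp
  · simp [splitVariable_X_self]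

lemma isFrobSplit_pow_sub {m : ℕ} (i j : Fin (m + 1)) (hij : j ≠ i) (n d : ℕ) (hn : 1 ≤ n) :
    IsFrobSplit (aeval (Function.update X i (X i ^ (n + 1) - X j ^ d * X i)) :
      MvPolynomial (Fin (m + 1)) k →ₐ[k] MvPolynomial (Fin (m + 1)) k) (X i ^ n) := by
  obtain ⟨l, hl⟩ := exists_splitVariable_X (k := k) i j hij
  refine isFrobSplit_of_variable i _ (fun j hj => by simp [hj])
    (-(Polynomial.C (X l ^ d) * Polynomial.X)) ?_ ?_
  · rw [Polynomial.degree_neg]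
    refine (Polynomial.degree_C_mul_X_le _).trans_lt ?_
    exact_mod_cast (by omega : 1 < n + 1)
  · simp [splitVariable_X_self, hl, sub_eq_add_neg]

lemma isFrobSplit_add_pow {m : ℕ} (i j : Fin (m + 1)) (hij : j ≠ i) (d : ℕ) :
    IsFrobSplit (aeval (Function.update X i (X i + X j ^ d)) :
      MvPolynomial (Fin (m + 1)) k →ₐ[k] MvPolynomial (Fin (m + 1)) k) 1 := by
  obtain ⟨l, hl⟩ := exists_splitVariable_X (k := k) i j hij
  rw [← pow_zero (X i)]
  refine isFrobSplit_of_variable i _ (fun j hj => by simp [hj]) (Polynomial.C (X l ^ d)) ?_ ?_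
  · exact Polynomial.degree_C_le.trans_lt (by exact_mod_cast (by omega : 0 < 0 + 1))
  · simp [splitVariable_X_self, hl]

/-- The norm of `Y` over the unitriangular group, where `q = r + 2` is the field size. -/
def dicksonN (k : Type u) [Field k] (r : ℕ) : MvPolynomial (Fin 3) k :=
  X 1 ^ (r + 2) - X 0 ^ (r + 1) * X 1

/-- The Dickson invariant `X Y ^ q - X ^ q Y`, where `q = r + 2`. -/
def dicksonL (k : Type u) [Field k] (r : ℕ) : MvPolynomial (Fin 3) k :=
  X 0 * dicksonN k r

/-- The Dickson invariant `(X Y ^ q² - X ^ q² Y) / L`, where `q = r + 2`. -/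
def dicksonQ (k : Type u) [Field k] (r : ℕ) : MvPolynomial (Fin 3) k :=
  dicksonN k r ^ (r + 1) + X 0 ^ ((r + 1) * (r + 2))

/-- The endomorphism whose image is the ring generated by `L ^ (q - 1)`, `Q` and `Z ^ (q - 1)`. -/
def dicksonHom (k : Type u) [Field k] (r : ℕ) :
    MvPolynomial (Fin 3) k →ₐ[k] MvPolynomial (Fin 3) k :=
  aeval ![-dicksonL k r ^ (r + 1), dicksonQ k r, X 2 ^ (r + 1)]

lemma isFrobSplit_dicksonHom (r : ℕ) : IsFrobSplit (dicksonHom k r)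
    (X 0 ^ ((r + 1) * (r + 2)) * X 0 ^ r * dicksonN k r ^ r * X 1 ^ (r + 1) * X 2 ^ r) := by
  have h1 := isFrobSplit_pow_sub (k := k) (m := 2) 0 1 (by decide) (r + 2) 1 (by omega)
  have h2 := isFrobSplit_add_pow (k := k) (m := 2) 1 0 (by decide) (r + 2)
  have h3 := isFrobSplit_pow (k := k) (m := 2) 0 r
  have h4 := isFrobSplit_pow (k := k) (m := 2) 1 r
  have h5 := isFrobSplit_pow_sub (k := k) (m := 2) 1 0 (by decide) (r + 1) (r + 1) (by omega)
  have h6 := isFrobSplit_pow (k := k) (m := 2) 2 r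
  have h := ((((h1.comp h2).comp h3).comp h4).comp h5).comp h6
  convert h using 1
  · refine MvPolynomial.algHom_ext fun i => ?_
    fin_cases i
    · simp [dicksonHom, dicksonL, dicksonN, Function.update, mul_pow]
      ring
    · simp [dicksonHom, dicksonQ, dicksonN, Function.update]
      ring
    · simp [dicksonHom, Function.update]
  · simp [dicksonN, Function.update, -mul_eq_mul_right_iff, -mul_eq_mul_left_iff]
    ring

/-- The endomorphism `X₀ ↦ X₀ ^ (q - 1)`, `X₂ ↦ X₂ ^ (q - 1)`, where `q = r + 2`. -/
def kummerHom (k : Type u) [Field k] (r : ℕ) :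
    MvPolynomial (Fin 3) k →ₐ[k] MvPolynomial (Fin 3) k :=
  aeval ![X 0 ^ (r + 1), X 1, X 2 ^ (r + 1)]

lemma isFrobSplit_kummerHom (r : ℕ) : IsFrobSplit (kummerHom k r) (X 0 ^ r * X 2 ^ r) := by
  have h := (isFrobSplit_pow (k := k) (m := 2) 0 r).comp (isFrobSplit_pow (k := k) (m := 2) 2 r)
  convert h using 1
  · refine MvPolynomial.algHom_ext fun i => ?_
    fin_cases i <;> simp [kummerHom, Function.update]
  · simp [Function.update]

end FrobeniusEndomorphisms

section PolyAct

variable {k : Type u} [Field k]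

lemma polyAct_X {m : ℕ} (M : Matrix (Fin m) (Fin m) k) (i : Fin m) :
    polyAct M (X i) = ∑ j, C (M i j) * X j := by
  simp [polyAct, smul_eq_C_mul]

lemma polyAct_mul {m : ℕ} (M N : Matrix (Fin m) (Fin m) k) :
    polyAct (N * M) = (polyAct M).comp (polyAct N) := by
  refine MvPolynomial.algHom_ext fun i => ?_
  simp only [polyAct_X, AlgHom.comp_apply, map_sum, map_mul, algHom_C, Matrix.mul_apply,
    Finset.sum_mul, Finset.mul_sum, algebraMap_eq]
  rw [Finset.sum_comm]
  simp only [mul_assoc]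

lemma polyAct_mul_apply {m : ℕ} (M N : Matrix (Fin m) (Fin m) k) (f : MvPolynomial (Fin m) k) :
    polyAct (N * M) f = polyAct M (polyAct N f) := by
  rw [polyAct_mul, AlgHom.comp_apply]

lemma polyAct_one {m : ℕ} : polyAct (1 : Matrix (Fin m) (Fin m) k) = AlgHom.id k _ := by
  refine MvPolynomial.algHom_ext fun i => ?_
  simp [polyAct_X, Matrix.one_apply]

lemma polyAct_one_apply {m : ℕ} (f : MvPolynomial (Fin m) k) :
    polyAct (1 : Matrix (Fin m) (Fin m) k) f = f := by
  rw [polyAct_one, AlgHom.id_apply]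

lemma exists_C_mul_of_isFrob {m : ℕ} {f : MvPolynomial (Fin m) k →ₐ[k] MvPolynomial (Fin m) k}
    {Φ : MvPolynomial (Fin m) k →+ MvPolynomial (Fin m) k}
    (h : IsFrob (f : MvPolynomial (Fin m) k →+* MvPolynomial (Fin m) k) Φ)
    {A B : Matrix (Fin m) (Fin m) k} (hAB : A * B = 1)
    (hf : ∀ a, polyAct A (f a) = f a) :
    ∃ c : k, ∀ x, Φ (polyAct A x) = C c * Φ x := by
  have hBA : B * A = 1 := mul_eq_one_comm.mp hAB
  have hAB' (x) : polyAct A (polyAct B x) = x := by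
    rw [← polyAct_mul_apply, hBA, polyAct_one_apply]
  have hBA' (x) : polyAct B (polyAct A x) = x := by
    rw [← polyAct_mul_apply, hAB, polyAct_one_apply]
  have hfB (a) : polyAct B (f a) = f a := by
    conv_lhs => rw [← hf a, hBA']
  obtain ⟨s, hs⟩ := h.exists_eq_apply_mul (Φ.comp (polyAct A : _ →+* _).toAddMonoidHom)
    (fun a x => by
      have := h.1 a (polyAct A x)
      simp only [AddMonoidHom.comp_apply, RingHom.toAddMonoidHom_eq_coe, AddMonoidHom.coe_coe,
        RingHom.coe_coe, map_mul, hf] at this ⊢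
      exact this)
  obtain ⟨s', hs'⟩ := h.exists_eq_apply_mul (Φ.comp (polyAct B : _ →+* _).toAddMonoidHom)
    (fun a x => by
      have := h.1 a (polyAct B x)
      simp only [AddMonoidHom.comp_apply, RingHom.toAddMonoidHom_eq_coe, AddMonoidHom.coe_coe,
        RingHom.coe_coe, map_mul, hfB] at this ⊢
      exact this)
  replace hs (x) : Φ (polyAct A x) = Φ (s * x) := hs x
  replace hs' (x) : Φ (polyAct B x) = Φ (s' * x) := hs' x
  have hu : s * polyAct B s' = 1 := by
    refine h.injective_apply_mul fun x => ?_
    rw [one_mul, mul_assoc, ← hs, map_mul, hAB', ← hs', hBA']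
  obtain ⟨c, -, rfl⟩ := MvPolynomial.isUnit_iff_eq_C_of_isReduced.mp (IsUnit.of_mul_eq_one _ hu)
  refine ⟨c, fun x => ?_⟩
  rw [hs, ← h.1]
  congr 2
  exact (f.commutes c).symm

end PolyAct

section Dickson

variable {p : ℕ} [Fact p.Prime] {r : ℕ}

/-- The block matrix with blocks `h` and `(det h)⁻¹`. -/
def blockMat {k : Type u} [Field k] (h : Matrix (Fin 2) (Fin 2) k) : Matrix (Fin 3) (Fin 3) k :=
  !![h 0 0, h 0 1, 0; h 1 0, h 1 1, 0; 0, 0, (h.det)⁻¹]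

lemma blockMat_mul {k : Type u} [Field k] (g h : Matrix (Fin 2) (Fin 2) k) :
    blockMat (g * h) = blockMat g * blockMat h := by
  ext i j
  fin_cases i <;> fin_cases j <;>
    simp [blockMat, Matrix.mul_apply, Fin.sum_univ_succ, Matrix.det_mul]; ring

lemma blockMat_one {k : Type u} [Field k] : blockMat (1 : Matrix (Fin 2) (Fin 2) k) = 1 := by
  ext i j
  fin_cases i <;> fin_cases j <;> simp [blockMat]

lemma dicksonN_ne_zero {k : Type u} [Field k] (r : ℕ) : dicksonN k r ≠ 0 := by
  intro h
  have := congrArg (aeval ![(0 : k), 1, 0]) h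
  simp [dicksonN] at this

lemma dicksonL_eq {k : Type u} [Field k] (r : ℕ) :
    dicksonL k r = X 0 * X 1 ^ (r + 2) - X 0 ^ (r + 2) * X 1 := by
  rw [dicksonL, dicksonN]; ring

lemma zmod_pow_sub_one (hp : p = r + 2) {a : ZMod p} (ha : a ≠ 0) : a ^ (r + 1) = 1 := by
  have := ZMod.pow_card_sub_one_eq_one ha
  rwa [show p - 1 = r + 1 by omega] at this

lemma C_add_pow (hp : p = r + 2) (a b : ZMod p) (x y : MvPolynomial (Fin 3) (ZMod p)) :
    (C a * x + C b * y) ^ (r + 2) = C a * x ^ (r + 2) + C b * y ^ (r + 2) := by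
  rw [← hp, add_pow_char, mul_pow, mul_pow, ← map_pow, ← map_pow, ZMod.pow_card, ZMod.pow_card]

lemma sub_pow_add_two (hp : p = r + 2) (x y : MvPolynomial (Fin 3) (ZMod p)) :
    (x - y) ^ (r + 2) = x ^ (r + 2) - y ^ (r + 2) := by
  rw [← hp, sub_pow_char]

lemma dicksonL_mul_dicksonQ (hp : p = r + 2) :
    dicksonL (ZMod p) r * dicksonQ (ZMod p) r =
      X 0 * (X 1 ^ (r + 2)) ^ (r + 2) - (X 0 ^ (r + 2)) ^ (r + 2) * X 1 := by
  have h : dicksonN (ZMod p) r ^ (r + 2) =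
      (X 1 ^ (r + 2)) ^ (r + 2) - (X 0 ^ (r + 1) * X 1) ^ (r + 2) := by
    rw [dicksonN, sub_pow_add_two hp]
  have : dicksonL (ZMod p) r * dicksonQ (ZMod p) r = X 0 * dicksonN (ZMod p) r ^ (r + 2) +
      X 0 * X 0 ^ ((r + 1) * (r + 2)) * dicksonN (ZMod p) r := by
    rw [dicksonL, dicksonQ]; ring
  rw [this, h, dicksonN]
  ring

lemma polyAct_blockMat_X (h : Matrix (Fin 2) (Fin 2) (ZMod p)) :
    polyAct (blockMat h) (X 0) = C (h 0 0) * X 0 + C (h 0 1) * X 1 ∧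
    polyAct (blockMat h) (X 1) = C (h 1 0) * X 0 + C (h 1 1) * X 1 ∧
    polyAct (blockMat h) (X 2) = C (h.det)⁻¹ * X 2 := by
  refine ⟨?_, ?_, ?_⟩ <;> simp [polyAct_X, blockMat, Fin.sum_univ_succ]

lemma polyAct_dicksonL (hp : p = r + 2) (h : Matrix (Fin 2) (Fin 2) (ZMod p)) :
    polyAct (blockMat h) (dicksonL (ZMod p) r) = C h.det * dicksonL (ZMod p) r := by
  obtain ⟨h0, h1, -⟩ := polyAct_blockMat_X h
  simp only [dicksonL_eq, map_sub, map_mul, map_pow, h0, h1, C_add_pow hp, Matrix.det_fin_two]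
  ring

lemma polyAct_dicksonQ (hp : p = r + 2) {h : Matrix (Fin 2) (Fin 2) (ZMod p)} (hh : h.det ≠ 0) :
    polyAct (blockMat h) (dicksonQ (ZMod p) r) = dicksonQ (ZMod p) r := by
  obtain ⟨h0, h1, -⟩ := polyAct_blockMat_X h
  have hL : C h.det * dicksonL (ZMod p) r ≠ 0 := by
    refine mul_ne_zero ?_ (mul_ne_zero (X_ne_zero _) (dicksonN_ne_zero r))
    simpa using hh
  refine mul_left_cancel₀ hL ?_
  rw [← polyAct_dicksonL hp, ← map_mul, dicksonL_mul_dicksonQ hp, polyAct_dicksonL hp, mul_assoc,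
    dicksonL_mul_dicksonQ hp]
  simp only [map_sub, map_mul, map_pow, h0, h1, C_add_pow hp, Matrix.det_fin_two]
  ring

lemma polyAct_dicksonHom (hp : p = r + 2) {h : Matrix (Fin 2) (Fin 2) (ZMod p)} (hh : h.det ≠ 0)
    (a : MvPolynomial (Fin 3) (ZMod p)) :
    polyAct (blockMat h) (dicksonHom (ZMod p) r a) = dicksonHom (ZMod p) r a := by
  suffices H : (polyAct (blockMat h)).comp (dicksonHom (ZMod p) r) = dicksonHom (ZMod p) r from
    DFunLike.congr_fun H a
  obtain ⟨-, -, h2⟩ := polyAct_blockMat_X h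
  refine MvPolynomial.algHom_ext fun i => ?_
  have hC {a : ZMod p} (ha : a ≠ 0) : (C a : MvPolynomial (Fin 3) (ZMod p)) ^ (r + 1) = 1 := by
    rw [← map_pow, zmod_pow_sub_one hp ha, C_1]
  fin_cases i
  · simp [dicksonHom]
    rw [polyAct_dicksonL hp, mul_pow, hC hh, one_mul]
  · simp [dicksonHom, polyAct_dicksonQ hp hh]
  · simp [dicksonHom]
    rw [h2, mul_pow, hC (inv_ne_zero hh), one_mul]

lemma blockMat_mul_inv {k : Type u} [Field k] {h : Matrix (Fin 2) (Fin 2) k} (hh : h.det ≠ 0) :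
    blockMat h * blockMat h⁻¹ = 1 := by
  rw [← blockMat_mul, Matrix.mul_nonsing_inv _ (isUnit_iff_ne_zero.mpr hh), blockMat_one]

lemma polyAct_diagonal_dicksonN (hp : p = r + 2) {D : Fin 2 → ZMod p} (hD : ∀ i, D i ≠ 0) :
    polyAct (blockMat (diagonal D)) (dicksonN (ZMod p) r) = C (D 1) * dicksonN (ZMod p) r := by
  obtain ⟨h0, h1, -⟩ := polyAct_blockMat_X (diagonal D)
  simp only [diagonal_apply_eq, ne_eq, zero_ne_one, not_false_eq_true, diagonal_apply_ne, C_0,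
    zero_mul, add_zero, one_ne_zero, zero_add] at h0 h1
  have h3 : (C (D 1) : MvPolynomial (Fin 3) (ZMod p)) ^ (r + 2) = C (D 1) := by
    rw [← map_pow, ← hp, ZMod.pow_card]
  have h4 : (C (D 0) : MvPolynomial (Fin 3) (ZMod p)) ^ (r + 1) = 1 := by
    rw [← map_pow, zmod_pow_sub_one hp (hD 0), C_1]
  simp only [dicksonN, map_sub, map_mul, map_pow, h0, h1, mul_pow, h3, h4]
  ring

lemma isFrob_apply_polyAct_diagonal (hp : p = r + 2)
    {Φ : MvPolynomial (Fin 3) (ZMod p) →+ MvPolynomial (Fin 3) (ZMod p)}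
    (h : IsFrob (dicksonHom (ZMod p) r : _ →+* MvPolynomial (Fin 3) (ZMod p)) Φ)
    (ht : Φ (X 0 ^ ((r + 1) * (r + 2)) * X 0 ^ r * dicksonN (ZMod p) r ^ r * X 1 ^ (r + 1) *
      X 2 ^ r) = 1) {D : Fin 2 → ZMod p} (hD : (diagonal D).det ≠ 0)
    (x : MvPolynomial (Fin 3) (ZMod p)) : Φ (polyAct (blockMat (diagonal D)) x) = Φ x := by
  obtain ⟨c, hc⟩ := exists_C_mul_of_isFrob h (blockMat_mul_inv hD) (polyAct_dicksonHom hp hD)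
  have hD' : ∀ i, D i ≠ 0 := by
    simpa [Fin.forall_fin_two] using hD
  obtain ⟨h0, h1, h2⟩ := polyAct_blockMat_X (diagonal D)
  simp only [diagonal_apply_eq, ne_eq, zero_ne_one, not_false_eq_true, diagonal_apply_ne, C_0,
    zero_mul, add_zero, one_ne_zero, zero_add] at h0 h1
  have hC (i) : (C (D i) : MvPolynomial (Fin 3) (ZMod p)) ^ (r + 1) = 1 := by
    rw [← map_pow, zmod_pow_sub_one hp (hD' i), C_1]
  have hdet : (C (D 0) * C (D 1) * C (diagonal D).det⁻¹ : MvPolynomial (Fin 3) (ZMod p)) = 1 := by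
    rw [← C_mul, ← C_mul, ← C_1, ← mul_inv_cancel₀ hD]
    simp [Fin.prod_univ_two]
  have := hc (X 0 ^ ((r + 1) * (r + 2)) * X 0 ^ r * dicksonN (ZMod p) r ^ r * X 1 ^ (r + 1) *
      X 2 ^ r)
  have key : polyAct (blockMat (diagonal D)) (X 0 ^ ((r + 1) * (r + 2)) * X 0 ^ r *
      dicksonN (ZMod p) r ^ r * X 1 ^ (r + 1) * X 2 ^ r) = X 0 ^ ((r + 1) * (r + 2)) * X 0 ^ r *
      dicksonN (ZMod p) r ^ r * X 1 ^ (r + 1) * X 2 ^ r := by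
    simp only [map_mul, map_pow, h0, h1, h2, polyAct_diagonal_dicksonN hp hD', mul_pow,
      pow_mul, hC, one_mul]
    calc _ = (C (D 0) * C (D 1) * C (diagonal D).det⁻¹) ^ r * ((X 0 ^ (r + 1)) ^ (r + 2) * X 0 ^ r *
      dicksonN (ZMod p) r ^ r * X 1 ^ (r + 1) * X 2 ^ r) := by ring
      _ = _ := by rw [hdet, one_pow, one_mul]
  rw [key, ht, mul_one] at this
  rw [hc, ← this, one_mul]

lemma isFrob_apply_polyAct_transvection (hp : p = r + 2)
    {Φ : MvPolynomial (Fin 3) (ZMod p) →+ MvPolynomial (Fin 3) (ZMod p)}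
    (h : IsFrob (dicksonHom (ZMod p) r : _ →+* MvPolynomial (Fin 3) (ZMod p)) Φ)
    {t : MvPolynomial (Fin 3) (ZMod p)} (ht : Φ t = 1) {i j : Fin 2} (hij : i ≠ j) (a : ZMod p)
    (x : MvPolynomial (Fin 3) (ZMod p)) :
    Φ (polyAct (blockMat (transvection i j a)) x) = Φ x := by
  have hd : (transvection i j a).det ≠ 0 := by rw [det_transvection_of_ne _ _ hij]; simp
  obtain ⟨c, hc⟩ := exists_C_mul_of_isFrob h (blockMat_mul_inv hd) (polyAct_dicksonHom hp hd)
  have hn (n : ℕ) (x) : Φ (polyAct (blockMat (transvection i j ((n : ZMod p) * a))) x) =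
      C (c ^ n) * Φ x := by
    induction n generalizing x with
    | zero => simp [transvection_zero, blockMat_one, polyAct_one_apply]
    | succ n ih =>
      rw [Nat.cast_succ, add_mul, one_mul, add_comm, ← transvection_mul_transvection_same _ _ hij,
        blockMat_mul, polyAct_mul_apply, ih, hc, pow_succ, C_mul, mul_assoc]
  have := hn p t
  rw [CharP.cast_eq_zero, zero_mul, transvection_zero, blockMat_one, polyAct_one_apply, ht,
    mul_one, ZMod.pow_card] at this
  rw [hc, ← this, one_mul]

lemma isFrob_apply_polyAct (hp : p = r + 2)
    {Φ : MvPolynomial (Fin 3) (ZMod p) →+ MvPolynomial (Fin 3) (ZMod p)}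
    (h : IsFrob (dicksonHom (ZMod p) r : _ →+* MvPolynomial (Fin 3) (ZMod p)) Φ)
    (ht : Φ (X 0 ^ ((r + 1) * (r + 2)) * X 0 ^ r * dicksonN (ZMod p) r ^ r * X 1 ^ (r + 1) *
      X 2 ^ r) = 1) {M : Matrix (Fin 2) (Fin 2) (ZMod p)} (hM : M.det ≠ 0)
    (x : MvPolynomial (Fin 3) (ZMod p)) : Φ (polyAct (blockMat M) x) = Φ x := by
  refine diagonal_transvection_induction_of_det_ne_zero
    (fun M => ∀ x, Φ (polyAct (blockMat M) x) = Φ x) M hM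
    (fun D hD x => isFrob_apply_polyAct_diagonal hp h ht hD x)
    (fun t x => isFrob_apply_polyAct_transvection hp h ht t.hij t.c x)
    (fun A B _ _ hA hB x => ?_) x
  rw [blockMat_mul, polyAct_mul_apply, hB, hA]

end Dickson

section Reynolds

variable {k : Type u} [Field k] {m : ℕ}

lemma mem_invariantRing_iff {K : Subgroup (SpecialLinearGroup (Fin m) k)}
    {f : MvPolynomial (Fin m) k} :
    f ∈ invariantRing K ↔ ∀ g ∈ K, polyAct (g : Matrix (Fin m) (Fin m) k) f = f :=
  ⟨fun h g hg => h _ ⟨g, hg, rfl⟩, fun h _ ⟨g, hg, hM⟩ => hM ▸ h g hg⟩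

lemma exists_isFrob_of_card_ne_zero (K : Subgroup (SpecialLinearGroup (Fin m) k)) [Finite K]
    (hK : (Nat.card K : k) ≠ 0) {f : MvPolynomial (Fin m) k →ₐ[k] MvPolynomial (Fin m) k}
    {Φ : MvPolynomial (Fin m) k →+ MvPolynomial (Fin m) k}
    (h : IsFrob (f : MvPolynomial (Fin m) k →+* MvPolynomial (Fin m) k) Φ)
    (hf : ∀ g ∈ K, ∀ a, polyAct (g : Matrix (Fin m) (Fin m) k) (f a) = f a)
    (hΦ : ∀ g ∈ K, ∀ x, Φ (polyAct (g : Matrix (Fin m) (Fin m) k) x) = Φ x) :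
    ∃ (f' : MvPolynomial (Fin m) k →+* invariantRing K)
      (Φ' : invariantRing K →+ MvPolynomial (Fin m) k), IsFrob f' Φ' := by
  classical
  have := Fintype.ofFinite K
  let ρ : MvPolynomial (Fin m) k →ₗ[k] MvPolynomial (Fin m) k :=
    (Nat.card K : k)⁻¹ • ∑ g : K, (polyAct (g : Matrix (Fin m) (Fin m) k)).toLinearMap
  have hρ (x) : ρ x = (Nat.card K : k)⁻¹ • ∑ g : K, polyAct (g : Matrix (Fin m) (Fin m) k) x := by
    simp [ρ]
  refine ⟨_, _, h.codRestrict (invariantRing K)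
    (fun a => mem_invariantRing_iff.mpr fun g hg => hf g hg a) ρ.toAddMonoidHom
    (fun x => mem_invariantRing_iff.mpr fun g hg => ?_) (fun x hx => ?_) (fun x hx y => ?_)
    fun x => ?_⟩
  · change polyAct _ (ρ x) = ρ x
    rw [hρ, map_smul, map_sum]
    congr 1
    refine Fintype.sum_equiv (Equiv.mulRight (⟨g, hg⟩ : K)) _ _ fun s => ?_
    rw [← polyAct_mul_apply]
    rfl
  · change ρ x = x
    rw [hρ, Finset.sum_congr rfl fun (g : K) _ => mem_invariantRing_iff.mp hx g g.2, Finset.sum_const,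
      Finset.card_univ, ← Nat.card_eq_fintype_card, ← Nat.cast_smul_eq_nsmul k, smul_smul,
      inv_mul_cancel₀ hK, one_smul]
  · change ρ (x * y) = x * ρ y
    simp only [hρ, map_mul]
    rw [Finset.sum_congr rfl fun (g : K) _ => by rw [mem_invariantRing_iff.mp hx g g.2],
      ← Finset.mul_sum, mul_smul_comm]
  · change Φ (ρ x) = Φ x
    have hsmul (c : k) (y) : Φ (c • y) = c • Φ y := by
      rw [smul_eq_C_mul, smul_eq_C_mul, ← h.1]
      congr 2
      exact (f.commutes c).symm
    rw [hρ, hsmul, map_sum, Finset.sum_congr rfl fun (g : K) _ => hΦ g g.2 x, Finset.sum_const,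
      Finset.card_univ, ← Nat.card_eq_fintype_card, ← Nat.cast_smul_eq_nsmul k, smul_smul,
      inv_mul_cancel₀ hK, one_smul]

/-- If `θ` matches invariants of `K'` with invariants of `K`, a Frobenius extension of the former
is one of the latter. -/
lemma exists_isFrob_transfer {K K' : Subgroup (SpecialLinearGroup (Fin m) k)}
    (θ : MvPolynomial (Fin m) k →+* MvPolynomial (Fin m) k) (hθ : Function.Injective θ)
    (h1 : ∀ f ∈ invariantRing K', θ f ∈ invariantRing K)
    (h2 : ∀ f ∈ invariantRing K, ∃ f' ∈ invariantRing K', θ f' = f)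
    (h : ∃ (f' : MvPolynomial (Fin m) k →+* invariantRing K')
      (Φ' : invariantRing K' →+ MvPolynomial (Fin m) k), IsFrob f' Φ') :
    ∃ (f' : MvPolynomial (Fin m) k →+* invariantRing K)
      (Φ' : invariantRing K →+ MvPolynomial (Fin m) k), IsFrob f' Φ' := by
  let θ' : invariantRing K' →+* invariantRing K :=
    (θ.comp (invariantRing K').val.toRingHom).codRestrict (invariantRing K) fun f => h1 f f.2
  have hb : Function.Bijective θ' := by
    refine ⟨fun a b hab => Subtype.ext (hθ (congrArg Subtype.val hab)), fun b => ?_⟩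
    obtain ⟨f', hf', hb⟩ := h2 b b.2
    exact ⟨⟨f', hf'⟩, Subtype.ext hb⟩
  obtain ⟨f, Φ, h⟩ := h
  exact ⟨_, _, h.comp (IsFrob.of_ringEquiv (RingEquiv.ofBijective θ' hb))⟩

end Reynolds

section Shift

lemma exists_comp_of_shift_invariant {p : ℕ} [Fact p.Prime] {B : Type*} [CommRing B] [IsDomain B]
    [Algebra (ZMod p) B] {b : B} (hb : b ≠ 0) (f : Polynomial B)
    (hf : ∀ a : ZMod p, f.comp (Polynomial.X + Polynomial.C (algebraMap _ B a * b)) = f) :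
    ∃ g : Polynomial B, g.comp (Polynomial.X ^ p - Polynomial.C (b ^ (p - 1)) * Polynomial.X) =
      f := by
  have hp : p.Prime := Fact.out
  have : CharP B p := charP_of_injective_algebraMap (algebraMap (ZMod p) B).injective p
  have : ExpChar B p := ExpChar.prime hp
  set P : Polynomial B := Polynomial.X ^ p - Polynomial.C (b ^ (p - 1)) * Polynomial.X with hP
  have hdeg : (Polynomial.C (b ^ (p - 1)) * Polynomial.X).degree < (p : WithBot ℕ) :=
    (Polynomial.degree_C_mul_X_le _).trans_lt (by exact_mod_cast hp.one_lt)
  have hmonic : P.Monic := by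
    rw [hP, sub_eq_add_neg]
    exact Polynomial.monic_X_pow_add (by rwa [Polynomial.degree_neg])
  have hPdeg : P.natDegree = p := by
    rw [hP, Polynomial.natDegree_sub_eq_left_of_natDegree_lt, Polynomial.natDegree_X_pow]
    rw [Polynomial.natDegree_X_pow]
    refine lt_of_le_of_lt ?_ hp.one_lt
    simpa using Polynomial.natDegree_C_mul_X_pow_le (b ^ (p - 1)) 1
  have hPinv (a : ZMod p) : P.comp (Polynomial.X + Polynomial.C (algebraMap _ B a * b)) = P := by
    have h1 : (algebraMap (ZMod p) B a * b) ^ p =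
        b ^ (p - 1) * (algebraMap (ZMod p) B a * b) := by
      rw [mul_pow, ← map_pow, ZMod.pow_card, mul_left_comm, ← pow_succ,
        Nat.sub_add_cancel hp.one_le]
    rw [hP, Polynomial.sub_comp, Polynomial.pow_comp, Polynomial.mul_comp, Polynomial.X_comp,
      Polynomial.C_comp, add_pow_expChar, ← Polynomial.C_pow, h1, Polynomial.C_mul]
    ring
  induction hn : f.natDegree using Nat.strong_induction_on generalizing f with
  | _ n ih =>
  subst hn
  have hdiv := Polynomial.modByMonic_add_div f P
  have hlt : (f %ₘ P).degree < P.degree := Polynomial.degree_modByMonic_lt _ hmonic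
  have hlt' : (f %ₘ P).natDegree < p := by
    rw [← hPdeg]
    exact Polynomial.natDegree_modByMonic_lt _ hmonic (fun h => by
      rw [h, Polynomial.natDegree_one] at hPdeg; exact hp.ne_zero hPdeg.symm)
  have hcomp (a : ZMod p) :
      (f /ₘ P).comp (Polynomial.X + Polynomial.C (algebraMap _ B a * b)) = f /ₘ P ∧
      (f %ₘ P).comp (Polynomial.X + Polynomial.C (algebraMap _ B a * b)) = f %ₘ P := by
    have h := congrArg
      (fun g => g.comp (Polynomial.X + Polynomial.C (algebraMap _ B a * b))) hdiv
    simp only [Polynomial.add_comp, Polynomial.mul_comp, hPinv, hf] at h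
    have hd : ((f %ₘ P).comp (Polynomial.X + Polynomial.C (algebraMap _ B a * b))).degree <
        P.degree := by
      rw [Polynomial.degree_eq_natDegree hmonic.ne_zero, hPdeg]
      refine Polynomial.degree_le_natDegree.trans_lt ?_
      rw [Polynomial.natDegree_comp, Polynomial.natDegree_X_add_C, mul_one]
      exact_mod_cast hlt'
    obtain ⟨h1, h2⟩ := Polynomial.div_modByMonic_unique _ _ hmonic ⟨h, hd⟩
    exact ⟨h1.symm, h2.symm⟩
  have hconst : f %ₘ P - Polynomial.C ((f %ₘ P).eval 0) = 0 := by
    refine Polynomial.eq_zero_of_natDegree_lt_card_of_eval_eq_zero _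
      (f := fun a : ZMod p => algebraMap (ZMod p) B a * b) ?_ (fun a => ?_) ?_
    · intro a a' h
      exact (algebraMap (ZMod p) B).injective (mul_right_cancel₀ hb h)
    · have := congrArg (Polynomial.eval 0) (hcomp a).2
      simp only [Polynomial.eval_comp, Polynomial.eval_add, Polynomial.eval_X,
        Polynomial.eval_C, zero_add] at this
      simp [this]
    · rw [ZMod.card, Polynomial.natDegree_sub_C]
      exact hlt'
  by_cases h0 : f /ₘ P = 0
  · refine ⟨Polynomial.C ((f %ₘ P).eval 0), ?_⟩
    rw [Polynomial.C_comp, ← sub_eq_zero.mp hconst]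
    conv_rhs => rw [← hdiv, h0, mul_zero, add_zero]
  · have hle : P.degree ≤ f.degree := not_lt.mp fun h =>
      h0 ((Polynomial.divByMonic_eq_zero_iff hmonic).mpr h)
    have hle' := Polynomial.natDegree_le_natDegree hle
    obtain ⟨g, hg⟩ := ih _ (by
      rw [Polynomial.natDegree_divByMonic _ hmonic]
      have := hp.pos
      omega) (f /ₘ P) (fun a => (hcomp a).1) rfl
    refine ⟨Polynomial.C ((f %ₘ P).eval 0) + Polynomial.X * g, ?_⟩
    rw [Polynomial.add_comp, Polynomial.C_comp, Polynomial.mul_comp, Polynomial.X_comp, hg,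
      ← sub_eq_zero.mp hconst, hdiv]

lemma splitVariable_apply_of_fixed {k : Type u} [Field k] {m : ℕ} (i : Fin (m + 1))
    (φ : MvPolynomial (Fin (m + 1)) k →ₐ[k] MvPolynomial (Fin (m + 1)) k)
    (hφ : ∀ j ≠ i, φ (X j) = X j) (f : MvPolynomial (Fin (m + 1)) k) :
    splitVariable k i (φ f) = (splitVariable k i f).comp (splitVariable k i (φ (X i))) := by
  suffices H : ((splitVariable k i).toRingEquiv.toRingHom.comp (φ : _ →+* _)) =
      (Polynomial.compRingHom (splitVariable k i (φ (X i)))).comp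
        (splitVariable k i).toRingEquiv.toRingHom from DFunLike.congr_fun H f
  refine MvPolynomial.ringHom_ext (fun r => ?_) fun j => ?_
  · have h1 : splitVariable k i (MvPolynomial.C r) = Polynomial.C (algebraMap k _ r) :=
      (splitVariable k i).commutes r
    simp [h1, algHom_C]
  · by_cases hji : j = i
    · subst hji
      simp [splitVariable_X_self]
    · obtain ⟨b, hb⟩ := exists_splitVariable_X (k := k) i j hji
      simp [hφ j hji, hb]

lemma exists_of_shift_invariant {p : ℕ} [Fact p.Prime] {m : ℕ} {i j : Fin (m + 1)} (hij : j ≠ i)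
    (f : MvPolynomial (Fin (m + 1)) (ZMod p))
    (hf : ∀ a : ZMod p, aeval (R := ZMod p) (Function.update X i (X i + C a * X j)) f = f) :
    ∃ g, aeval (R := ZMod p) (Function.update X i (X i ^ p - X j ^ (p - 1) * X i)) g = f := by
  obtain ⟨l, hl⟩ := exists_splitVariable_X (k := ZMod p) i j hij
  obtain ⟨g, hg⟩ := exists_comp_of_shift_invariant (p := p) (X_ne_zero l)
    (splitVariable (ZMod p) i f) (fun a => by
      conv_rhs => rw [← hf a, splitVariable_apply_of_fixed i _ (fun j hj => by simp [hj])]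
      have h1 : splitVariable (ZMod p) i (MvPolynomial.C a) = Polynomial.C (algebraMap _ _ a) :=
        (splitVariable (ZMod p) i).commutes a
      simp [splitVariable_X_self, hl, h1])
  refine ⟨(splitVariable (ZMod p) i).symm g, (splitVariable (ZMod p) i).injective ?_⟩
  rw [splitVariable_apply_of_fixed i _ (fun j hj => by simp [hj]), ← hg]
  simp [splitVariable_X_self, hl]

lemma X_dvd_sub_aeval_update {σ k : Type*} [CommRing k] [DecidableEq σ] (i : σ)
    (f : MvPolynomial σ k) : X i ∣ f - aeval (Function.update X i 0) f := by
  rw [← Ideal.mem_span_singleton, ← Ideal.Quotient.eq]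
  suffices H : Ideal.Quotient.mkₐ k (Ideal.span {(X i : MvPolynomial σ k)}) =
      (Ideal.Quotient.mkₐ k (Ideal.span {(X i : MvPolynomial σ k)})).comp
        (aeval (Function.update X i 0)) from DFunLike.congr_fun H f
  refine MvPolynomial.algHom_ext fun j => ?_
  by_cases hj : j = i
  · subst hj
    simp [Ideal.Quotient.eq_zero_iff_mem.mpr (Ideal.mem_span_singleton_self _)]
  · simp [hj]

lemma X_dvd_iff_aeval_update {σ k : Type*} [CommRing k] [DecidableEq σ] (i : σ)
    (f : MvPolynomial σ k) : X i ∣ f ↔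
    aeval (Function.update (X : σ → MvPolynomial σ k) i 0) f = 0 := by
  refine ⟨fun ⟨g, hg⟩ => by simp [hg], fun h => ?_⟩
  have := X_dvd_sub_aeval_update i f
  rwa [h, sub_zero] at this

lemma IsFrobSplit.injective {k S : Type*} [Field k] [CommRing S] [Algebra k S] {f : S →ₐ[k] S}
    {t : S} (hf : IsFrobSplit f t) : Function.Injective f := by
  obtain ⟨Φ, h, ht⟩ := hf
  intro a b hab
  have ha := h.1 a t
  have hb := h.1 b t
  rw [ht, mul_one] at ha hb
  rw [← ha, ← hb]
  exact congrArg (fun x => Φ (x * t)) hab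

end Shift

section SpecialLinearInvariants

section Coefficients

variable {k : Type u} [Field k]

lemma aeval_monomial_three (g : Fin 3 → MvPolynomial (Fin 3) k) (e : Fin 3 →₀ ℕ) (c : k) :
    aeval g (monomial e c) = C c * g 0 ^ e 0 * g 1 ^ e 1 * g 2 ^ e 2 := by
  rw [aeval_monomial, Finsupp.prod_fintype _ _ (fun i => pow_zero _), Fin.prod_univ_three,
    algebraMap_eq]
  ring

lemma monomial_three (e : Fin 3 →₀ ℕ) (c : k) :
    (monomial e c : MvPolynomial (Fin 3) k) = C c * X 0 ^ e 0 * X 1 ^ e 1 * X 2 ^ e 2 := by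
  rw [← aeval_monomial_three, aeval_X_left, AlgHom.id_apply]

lemma coeff_aeval_update_zero (f : MvPolynomial (Fin 3) k) (d : Fin 3 →₀ ℕ) :
    coeff d (aeval (Function.update (X : Fin 3 → MvPolynomial (Fin 3) k) 0 0) f) =
      if d 0 = 0 then coeff d f else 0 := by
  induction f using MvPolynomial.induction_on' with
  | monomial e c =>
    have : aeval (Function.update (X : Fin 3 → MvPolynomial (Fin 3) k) 0 0) (monomial e c) =
        if e 0 = 0 then monomial e c else 0 := by
      rw [aeval_monomial_three, monomial_three]
      split_ifs with h <;> simp [h, Function.update]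
    rw [this]
    by_cases hd : e = d
    · subst hd; split_ifs <;> simp
    · split_ifs <;> simp [coeff_monomial, hd]
  | add p q hp hq => rw [map_add, coeff_add, hp, hq, coeff_add]; split_ifs <;> simp

lemma coeff_aeval_update_C_mul (a : k) (f : MvPolynomial (Fin 3) k) (d : Fin 3 →₀ ℕ) :
    coeff d (aeval (Function.update (X : Fin 3 → MvPolynomial (Fin 3) k) 1 (C a * X 1)) f) =
      a ^ d 1 * coeff d f := by
  induction f using MvPolynomial.induction_on' with
  | monomial e c =>
    have : aeval (Function.update (X : Fin 3 → MvPolynomial (Fin 3) k) 1 (C a * X 1))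
        (monomial e c) = C (a ^ e 1) * monomial e c := by
      rw [aeval_monomial_three, monomial_three]
      simp [Function.update]
      ring
    rw [this, coeff_C_mul]
    by_cases hd : e = d
    · subst hd; rfl
    · simp [coeff_monomial, hd]
  | add p q hp hq => rw [map_add, coeff_add, hp, hq, coeff_add, mul_add]

lemma dvd_of_coeff_aeval_update_pow {n : ℕ} (f : MvPolynomial (Fin 3) k) (d : Fin 3 →₀ ℕ)
    (hd : coeff d (aeval (Function.update (X : Fin 3 → MvPolynomial (Fin 3) k) 1 (X 1 ^ n)) f) ≠ 0) :
    n ∣ d 1 := by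
  induction f using MvPolynomial.induction_on' with
  | monomial e c =>
    have : aeval (Function.update (X : Fin 3 → MvPolynomial (Fin 3) k) 1 (X 1 ^ n))
        (monomial e c) = monomial (e.update 1 (n * e 1)) c := by
      rw [aeval_monomial_three, monomial_three]
      simp [Function.update, pow_mul]
    rw [this, coeff_monomial] at hd
    have h := (ite_ne_right_iff.mp hd).1
    rw [← h]
    simp
  | add p q hp hq =>
    rw [map_add, coeff_add] at hd
    by_contra hn
    rw [not_imp_comm.mp hp hn, not_imp_comm.mp hq hn, add_zero] at hd
    exact hd rfl

end Coefficients

variable {p : ℕ} [Fact p.Prime] {r : ℕ}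

/-- The embedding of the polynomial ring as the ring generated by `L`, `Q` and `Z`. -/
def dicksonMap (k : Type u) [Field k] (r : ℕ) :
    MvPolynomial (Fin 3) k →ₐ[k] MvPolynomial (Fin 3) k :=
  aeval ![dicksonL k r, dicksonQ k r, X 2]

lemma dicksonMap_X {k : Type u} [Field k] (r : ℕ) :
    dicksonMap k r (X 0) = dicksonL k r ∧ dicksonMap k r (X 1) = dicksonQ k r ∧
      dicksonMap k r (X 2) = X 2 := by
  simp [dicksonMap]

lemma totalDegree_dicksonQ_le {k : Type u} [Field k] (r : ℕ) :
    (dicksonQ k r).totalDegree ≤ (r + 1) * (r + 2) := by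
  have hN : (dicksonN k r).totalDegree ≤ r + 2 := by
    refine (totalDegree_sub _ _).trans (max_le ?_ ?_)
    · rw [totalDegree_X_pow]
    · refine (totalDegree_mul _ _).trans ?_
      rw [totalDegree_X_pow, totalDegree_X]
  refine (totalDegree_add _ _).trans (max_le ?_ ?_)
  · exact (totalDegree_pow _ _).trans (Nat.mul_le_mul_left _ hN)
  · rw [totalDegree_X_pow]

lemma algHom_ext_three {k A : Type*} [CommSemiring k] [Semiring A] [Algebra k A]
    {f g : MvPolynomial (Fin 3) k →ₐ[k] A} (h0 : f (X 0) = g (X 0)) (h1 : f (X 1) = g (X 1))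
    (h2 : f (X 2) = g (X 2)) : f = g := by
  refine MvPolynomial.algHom_ext fun i => ?_
  fin_cases i
  exacts [h0, h1, h2]

lemma polyAct_lower (a : ZMod p) : polyAct (blockMat !![1, 0; a, 1]) =
    aeval (R := ZMod p) (Function.update X 1 (X 1 + C a * X 0)) := by
  obtain ⟨e0, e1, e2⟩ := polyAct_blockMat_X !![1, 0; a, 1]
  refine algHom_ext_three ?_ ?_ ?_
  · rw [e0]; simp
  · rw [e1]; simp [add_comm]
  · rw [e2]; simp [det_fin_two]

/-- The endomorphism whose image is the ring generated by `X`, `N` and `Z`. -/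
def dicksonNHom (k : Type u) [Field k] (r : ℕ) :
    MvPolynomial (Fin 3) k →ₐ[k] MvPolynomial (Fin 3) k :=
  aeval ![X 0, dicksonN k r, X 2]

lemma dicksonNHom_X {k : Type u} [Field k] (r : ℕ) :
    dicksonNHom k r (X 0) = X 0 ∧ dicksonNHom k r (X 1) = dicksonN k r ∧
      dicksonNHom k r (X 2) = X 2 := by
  simp [dicksonNHom]

lemma exists_dicksonN (hp : p = r + 2) (f : MvPolynomial (Fin 3) (ZMod p))
    (hf : ∀ a : ZMod p, polyAct (blockMat !![1, 0; a, 1]) f = f) :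
    ∃ g, dicksonNHom (ZMod p) r g = f := by
  obtain ⟨g, hg⟩ := exists_of_shift_invariant (p := p) (m := 2) (i := 1) (j := 0) (by decide) f
    (fun a => by rw [← polyAct_lower, hf a])
  refine ⟨g, ?_⟩
  rw [← hg]
  obtain ⟨e0, e1, e2⟩ := dicksonNHom_X (k := ZMod p) r
  have h : dicksonNHom (ZMod p) r =
      aeval (R := ZMod p) (Function.update X 1 (X 1 ^ p - X 0 ^ (p - 1) * X 1)) := by
    refine algHom_ext_three ?_ ?_ ?_
    · rw [e0, aeval_X, Function.update_of_ne (by decide)]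
    · have h1 : p - 1 = r + 1 := by omega
      have h2 : (X 1 : MvPolynomial (Fin 3) (ZMod p)) ^ p = X 1 ^ (r + 2) := congrArg _ hp
      rw [e1, aeval_X, Function.update_self, h1, h2, dicksonN]
    · rw [e2, aeval_X, Function.update_of_ne (by decide)]
  rw [h]

lemma dvd_of_torus_invariant (hp : p = r + 2) (f : MvPolynomial (Fin 3) (ZMod p))
    (hf : ∀ a : ZMod p, a ≠ 0 → polyAct (blockMat !![a⁻¹, 0; 0, a]) f = f) (d : Fin 3 →₀ ℕ)
    (hd : coeff d (aeval (Function.update (X : Fin 3 → MvPolynomial (Fin 3) (ZMod p)) 0 0) f) ≠ 0) :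
    r + 1 ∣ d 1 := by
  have h (a : ZMod p) (ha : a ≠ 0) : a ^ d 1 = 1 := by
    obtain ⟨e0, e1, e2⟩ := polyAct_blockMat_X !![a⁻¹, 0; 0, a]
    have hdet : !![a⁻¹, 0; 0, a].det = 1 := by
      rw [det_fin_two_of, inv_mul_cancel₀ ha, mul_zero, sub_zero]
    have h0 : polyAct (blockMat !![a⁻¹, 0; 0, a]) (X 0) = C a⁻¹ * X 0 := by
      rw [e0]; simp
    have h1 : polyAct (blockMat !![a⁻¹, 0; 0, a]) (X 1) = C a * X 1 := by
      rw [e1]; simp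
    rw [hdet, inv_one, C_1, one_mul] at e2
    have h : (aeval (Function.update X 0 0)).comp (polyAct (blockMat !![a⁻¹, 0; 0, a])) =
        (aeval (Function.update X 1 (C a * X 1))).comp
          (aeval (Function.update (X : Fin 3 → MvPolynomial (Fin 3) (ZMod p)) 0 0)) := by
      refine algHom_ext_three ?_ ?_ ?_
      · rw [AlgHom.comp_apply, AlgHom.comp_apply, h0, map_mul, aeval_X, Function.update_self,
          mul_zero, map_zero]
      · rw [AlgHom.comp_apply, AlgHom.comp_apply, h1, map_mul, algHom_C, aeval_X, algebraMap_eq,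
          Function.update_of_ne (by decide), aeval_X, Function.update_self]
      · rw [AlgHom.comp_apply, AlgHom.comp_apply, e2, aeval_X, Function.update_of_ne (by decide),
          aeval_X, Function.update_of_ne (by decide)]
    have h3 := congrArg (coeff d) (DFunLike.congr_fun h f)
    rw [AlgHom.comp_apply, AlgHom.comp_apply, hf a ha, coeff_aeval_update_C_mul] at h3
    exact (mul_eq_right₀ hd).mp h3.symm
  have := (FiniteField.forall_pow_eq_one_iff (ZMod p) (d 1)).mp fun a =>
    Units.ext (by rw [Units.val_pow_eq_pow_val, h a a.ne_zero, Units.val_one])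
  rwa [ZMod.card, show p - 1 = r + 1 by omega] at this

lemma dvd_of_unipotent_invariant (hp : p = r + 2) (f : MvPolynomial (Fin 3) (ZMod p))
    (hf : ∀ a : ZMod p, polyAct (blockMat !![1, 0; a, 1]) f = f) (d : Fin 3 →₀ ℕ)
    (hd : coeff d (aeval (Function.update (X : Fin 3 → MvPolynomial (Fin 3) (ZMod p)) 0 0) f) ≠ 0) :
    r + 2 ∣ d 1 := by
  obtain ⟨g, rfl⟩ := exists_dicksonN hp f hf
  refine dvd_of_coeff_aeval_update_pow
    (aeval (Function.update (X : Fin 3 → MvPolynomial (Fin 3) (ZMod p)) 0 0) g) d ?_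
  convert hd using 2
  obtain ⟨e0, e1, e2⟩ := dicksonNHom_X (k := ZMod p) r
  rw [← AlgHom.comp_apply, ← AlgHom.comp_apply]
  congr 1
  refine algHom_ext_three ?_ ?_ ?_
  · rw [AlgHom.comp_apply, AlgHom.comp_apply, e0]
    simp
  · rw [AlgHom.comp_apply, AlgHom.comp_apply, e1]
    simp [dicksonN]
  · rw [AlgHom.comp_apply, AlgHom.comp_apply, e2]
    simp

lemma exists_dicksonMap_of_X_zero (hp : p = r + 2) (f : MvPolynomial (Fin 3) (ZMod p))
    (hf : ∀ s : Matrix (Fin 2) (Fin 2) (ZMod p), s.det = 1 → polyAct (blockMat s) f = f) :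
    ∃ g, X 0 ∣ f - dicksonMap (ZMod p) r g ∧
      (dicksonMap (ZMod p) r g).totalDegree ≤ f.totalDegree := by
  set π := aeval (R := ZMod p) (Function.update (X : Fin 3 → MvPolynomial (Fin 3) (ZMod p)) 0 0)
    with hπ
  have hπ0 : π (X 0) = 0 := by simp [hπ]
  have hπ1 : π (X 1) = X 1 := by simp [hπ]
  have hπ2 : π (X 2) = X 2 := by simp [hπ]
  have hdvd (d : Fin 3 →₀ ℕ) (hd : coeff d (π f) ≠ 0) :
      d 0 = 0 ∧ (r + 1) * (r + 2) ∣ d 1 ∧ d.degree ≤ f.totalDegree := by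
    have h0 := hd
    rw [hπ, coeff_aeval_update_zero] at h0
    obtain ⟨h0, h0'⟩ := ite_ne_right_iff.mp h0
    refine ⟨h0, Nat.Coprime.mul_dvd_of_dvd_of_dvd ?_ ?_ ?_, ?_⟩
    · exact (Nat.coprime_self_add_right (m := r + 1) (n := 1)).mpr (Nat.coprime_one_right _)
    · refine dvd_of_torus_invariant hp f (fun a ha => hf _ ?_) d hd
      rw [det_fin_two_of, inv_mul_cancel₀ ha, mul_zero, sub_zero]
    · refine dvd_of_unipotent_invariant hp f (fun a => hf _ ?_) d hd
      rw [det_fin_two_of, one_mul, zero_mul, sub_zero]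
    · exact le_totalDegree (mem_support_iff.mpr h0')
  obtain ⟨g, hg, hdeg⟩ : ∃ g, π f = π (dicksonMap (ZMod p) r g) ∧
      (dicksonMap (ZMod p) r g).totalDegree ≤ f.totalDegree := by
    let W : AddSubmonoid (MvPolynomial (Fin 3) (ZMod p)) :=
      { carrier := {h | ∃ g, h = π (dicksonMap (ZMod p) r g) ∧
          (dicksonMap (ZMod p) r g).totalDegree ≤ f.totalDegree}
        add_mem' := fun ⟨a, ha, ha'⟩ ⟨b, hb, hb'⟩ => ⟨a + b, by rw [map_add, map_add, ha, hb], by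
          rw [map_add]; exact (totalDegree_add _ _).trans (max_le ha' hb')⟩
        zero_mem' := ⟨0, by rw [map_zero, map_zero], by rw [map_zero, totalDegree_zero]; simp⟩ }
    suffices hmem : π f ∈ W from hmem
    rw [(π f).as_sum]
    refine sum_mem fun d hd => ?_
    obtain ⟨h0, ⟨n, hn⟩, h2⟩ := hdvd d (mem_support_iff.mp hd)
    obtain ⟨-, e1, e2⟩ := dicksonMap_X (k := ZMod p) r
    have h3 : d.degree = (r + 1) * (r + 2) * n + d 2 := by
      rw [Finsupp.degree_eq_sum, Fin.sum_univ_three, h0, hn, zero_add]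
    have h4 (c : ZMod p) : dicksonMap (ZMod p) r (C c * X 1 ^ n * X 2 ^ d 2) =
        C c * dicksonQ (ZMod p) r ^ n * X 2 ^ d 2 := by
      rw [map_mul, map_mul, map_pow, map_pow, e1, e2, algHom_C, algebraMap_eq]
    have hπQ : π (dicksonQ (ZMod p) r) = X 1 ^ ((r + 1) * (r + 2)) := by
      rw [dicksonQ, dicksonN, map_add, map_pow, map_pow, map_sub, map_mul, map_pow, map_pow, hπ0,
        hπ1, zero_pow (by simp), zero_pow (by simp)]
      ring
    refine ⟨C (coeff d (π f)) * X 1 ^ n * X 2 ^ d 2, ?_, ?_⟩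
    · rw [h4, monomial_three, h0, hn, map_mul, map_mul, map_pow, map_pow, hπQ, hπ2, algHom_C,
        algebraMap_eq, pow_zero, mul_one, pow_mul _ _ n]
    · rw [h3] at h2
      refine le_trans ?_ h2
      rw [h4]
      refine (totalDegree_mul _ _).trans (add_le_add ((totalDegree_mul _ _).trans ?_) ?_)
      · rw [totalDegree_C, zero_add, mul_comm]
        exact (totalDegree_pow _ _).trans (Nat.mul_le_mul_left _ (totalDegree_dicksonQ_le r))
      · rw [totalDegree_X_pow]
  refine ⟨g, ?_, hdeg⟩
  rw [X_dvd_iff_aeval_update, map_sub, ← hπ, hg, sub_self]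

lemma dicksonL_dvd (hp : p = r + 2) (f : MvPolynomial (Fin 3) (ZMod p))
    (hf : ∀ s : Matrix (Fin 2) (Fin 2) (ZMod p), s.det = 1 → polyAct (blockMat s) f = f)
    (hX : X 0 ∣ f) : dicksonL (ZMod p) r ∣ f := by
  have hX1 : X 1 ∣ f := by
    obtain ⟨g, hg⟩ := hX
    have h := hf !![0, 1; -1, 0] (by simp [det_fin_two])
    obtain ⟨e0, -, -⟩ := polyAct_blockMat_X (p := p) !![0, 1; -1, 0]
    refine ⟨polyAct (blockMat !![0, 1; -1, 0]) g, ?_⟩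
    rw [← h, hg, map_mul, e0]
    simp
  obtain ⟨g, hg⟩ := exists_dicksonN hp f fun a => hf _ (by
    rw [det_fin_two_of, one_mul, zero_mul, sub_zero])
  obtain ⟨e0, e1, e2⟩ := dicksonNHom_X (k := ZMod p) r
  have hXg : X 1 ∣ g := by
    rw [X_dvd_iff_aeval_update, ← hg, ← AlgHom.comp_apply] at hX1
    rw [X_dvd_iff_aeval_update]
    refine Eq.trans (DFunLike.congr_fun (algHom_ext_three ?_ ?_ ?_) g) hX1
    · rw [AlgHom.comp_apply, e0]
    · rw [AlgHom.comp_apply, e1]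
      simp [dicksonN]
    · rw [AlgHom.comp_apply, e2]
  obtain ⟨g', rfl⟩ := hXg
  rw [map_mul, e1] at hg
  rw [← hg] at hX ⊢
  rcases (X_prime (R := ZMod p) (i := (0 : Fin 3))).dvd_or_dvd hX with h | ⟨q, hq⟩
  · rw [X_dvd_iff_aeval_update] at h
    simp [dicksonN] at h
  · exact ⟨q, by rw [hq, dicksonL]; ring⟩

lemma exists_dicksonMap_eq (hp : p = r + 2) (f : MvPolynomial (Fin 3) (ZMod p))
    (hf : ∀ s : Matrix (Fin 2) (Fin 2) (ZMod p), s.det = 1 → polyAct (blockMat s) f = f) :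
    ∃ g, dicksonMap (ZMod p) r g = f := by
  induction hn : f.totalDegree using Nat.strong_induction_on generalizing f with
  | _ n ih =>
  subst hn
  have hL := mul_ne_zero (X_ne_zero (R := ZMod p) (0 : Fin 3)) (dicksonN_ne_zero r)
  have hψ (g) (s : Matrix (Fin 2) (Fin 2) (ZMod p)) (hs : s.det = 1) :
      polyAct (blockMat s) (dicksonMap (ZMod p) r g) = dicksonMap (ZMod p) r g := by
    rw [← AlgHom.comp_apply]
    congr 1
    refine MvPolynomial.algHom_ext fun i => ?_
    obtain ⟨-, -, e2⟩ := polyAct_blockMat_X s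
    fin_cases i
    · simp [dicksonMap_X, polyAct_dicksonL hp, hs]
    · simp [dicksonMap_X, polyAct_dicksonQ hp (hs.trans_ne one_ne_zero)]
    · simp [dicksonMap_X, e2, hs]
  obtain ⟨g, hg, hdeg⟩ := exists_dicksonMap_of_X_zero hp f hf
  obtain ⟨f', hf'⟩ := dicksonL_dvd hp _ (fun s hs => by rw [map_sub, hf s hs, hψ g s hs]) hg
  have hinv (s : Matrix (Fin 2) (Fin 2) (ZMod p)) (hs : s.det = 1) :
      polyAct (blockMat s) f' = f' := by
    have h := congrArg (polyAct (blockMat s)) hf'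
    rw [map_sub, hf s hs, hψ g s hs, map_mul, polyAct_dicksonL hp, hs, C_1, one_mul, hf'] at h
    exact (mul_left_cancel₀ hL h).symm
  by_cases h0 : f' = 0
  · exact ⟨g, by rw [h0, mul_zero] at hf'; exact (sub_eq_zero.mp hf').symm⟩
  · have hlt : f'.totalDegree < f.totalDegree := by
      have h1 : (f - dicksonMap (ZMod p) r g).totalDegree ≤ f.totalDegree :=
        (totalDegree_sub _ _).trans (max_le le_rfl hdeg)
      rw [hf', dicksonL, totalDegree_mul_of_isDomain hL h0, totalDegree_mul_of_isDomain
        (X_ne_zero _) (dicksonN_ne_zero r), totalDegree_X] at h1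
      omega
    obtain ⟨g', hg'⟩ := ih _ hlt f' hinv rfl
    refine ⟨g + X 0 * g', ?_⟩
    rw [map_add, map_mul, (dicksonMap_X r).1, hg', ← hf', add_sub_cancel]

end SpecialLinearInvariants

section BlockSubgroups

lemma det_blockMat {k : Type u} [Field k] {h : Matrix (Fin 2) (Fin 2) k} (hh : h.det ≠ 0) :
    (blockMat h).det = 1 := by
  have : (blockMat h).det = h.det * h.det⁻¹ := by
    rw [blockMat, det_fin_three, det_fin_two]
    simp
    ring
  rw [this, mul_inv_cancel₀ hh]

/-- The embedding of `GL₂` into `SL₃`. -/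
def blockHom (k : Type u) [Field k] : GL (Fin 2) k →* SpecialLinearGroup (Fin 3) k where
  toFun h := ⟨blockMat h.val, det_blockMat (h.isUnit.map detMonoidHom).ne_zero⟩
  map_one' := Subtype.ext blockMat_one
  map_mul' g h := Subtype.ext (blockMat_mul g.val h.val)

lemma det_gl_ne_zero {k : Type u} [Field k] (h : GL (Fin 2) k) : h.val.det ≠ 0 :=
  (h.isUnit.map detMonoidHom).ne_zero

/-- The torus of matrices `diag(δ, 1, δ⁻¹)`. -/
def torusHom (k : Type u) [Field k] : kˣ →* SpecialLinearGroup (Fin 3) k where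
  toFun δ := ⟨diagonal ![(δ : k), 1, (δ : k)⁻¹], by simp [Fin.prod_univ_three]⟩
  map_one' := Subtype.ext (by ext i j; fin_cases i <;> fin_cases j <;> simp)
  map_mul' a b := Subtype.ext (by
    change diagonal _ = diagonal _ * diagonal _
    rw [diagonal_mul_diagonal]
    congr 1
    ext i
    fin_cases i <;> simp [mul_comm])

lemma polyAct_torusHom_X {k : Type u} [Field k] (δ : kˣ) :
    polyAct (torusHom k δ).val (X 0) = C (δ : k) * X 0 ∧
    polyAct (torusHom k δ).val (X 1) = X 1 ∧
    polyAct (torusHom k δ).val (X 2) = C (δ : k)⁻¹ * X 2 := by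
  have h : (torusHom k δ).val = diagonal ![(δ : k), 1, (δ : k)⁻¹] := rfl
  rw [h]
  refine ⟨?_, ?_, ?_⟩ <;> simp [polyAct_X, Fin.sum_univ_succ, diagonal]

variable {p : ℕ} [Fact p.Prime] {r : ℕ}

lemma card_map_ne_zero {A B : Type*} [Group A] [Group B] (f : A →* B) (D : Subgroup A)
    (hD : (Nat.card D : ZMod p) ≠ 0) : (Nat.card (D.map f) : ZMod p) ≠ 0 := by
  rw [Ne, ZMod.natCast_eq_zero_iff] at hD ⊢
  exact fun h => hD (h.trans (Subgroup.card_dvd_of_surjective _ (f.subgroupMap_surjective D)))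

lemma exists_isFrob_torus (hp : p = r + 2) (D : Subgroup (ZMod p)ˣ) :
    ∃ (f : MvPolynomial (Fin 3) (ZMod p) →+* invariantRing (D.map (torusHom (ZMod p))))
      (Φ : invariantRing (D.map (torusHom (ZMod p))) →+ MvPolynomial (Fin 3) (ZMod p)),
      IsFrob f Φ := by
  obtain ⟨Φ, hΦ, ht⟩ := isFrobSplit_kummerHom (k := ZMod p) r
  have hf (δ : (ZMod p)ˣ) (a) : polyAct (torusHom (ZMod p) δ).val (kummerHom (ZMod p) r a) =
      kummerHom (ZMod p) r a := by
    obtain ⟨e0, e1, e2⟩ := polyAct_torusHom_X δ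
    have hC {a : ZMod p} (ha : a ≠ 0) :
        (C a : MvPolynomial (Fin 3) (ZMod p)) ^ (r + 1) = 1 := by
      rw [← map_pow, zmod_pow_sub_one hp ha, C_1]
    have k0 : kummerHom (ZMod p) r (X 0) = X 0 ^ (r + 1) := by simp [kummerHom]
    have k1 : kummerHom (ZMod p) r (X 1) = X 1 := by simp [kummerHom]
    have k2 : kummerHom (ZMod p) r (X 2) = X 2 ^ (r + 1) := by simp [kummerHom]
    rw [← AlgHom.comp_apply]
    congr 1
    refine algHom_ext_three ?_ ?_ ?_
    · rw [AlgHom.comp_apply, k0, map_pow, e0, mul_pow, hC δ.ne_zero, one_mul]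
    · rw [AlgHom.comp_apply, k1, e1]
    · rw [AlgHom.comp_apply, k2, map_pow, e2, mul_pow, hC (inv_ne_zero δ.ne_zero), one_mul]
  refine exists_isFrob_of_card_ne_zero _ (card_map_ne_zero _ _ ?_) hΦ ?_ ?_
  · rw [Ne, ZMod.natCast_eq_zero_iff]
    intro h
    have h1 := h.trans (Subgroup.card_subgroup_dvd_card D)
    rw [Nat.card_eq_fintype_card, ZMod.card_units] at h1
    have := Nat.le_of_dvd (by omega) h1
    omega
  · rintro _ ⟨δ, -, rfl⟩ a
    exact hf δ a
  · rintro _ ⟨δ, -, rfl⟩ x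
    obtain ⟨c, hc⟩ := exists_C_mul_of_isFrob hΦ (B := (torusHom (ZMod p) δ⁻¹).val) (by
      have := congrArg Subtype.val (map_mul (torusHom (ZMod p)) δ δ⁻¹)
      rw [mul_inv_cancel, map_one] at this
      exact this.symm) (hf δ)
    obtain ⟨e0, e1, e2⟩ := polyAct_torusHom_X δ
    have h := hc (X 0 ^ r * X 2 ^ r)
    have key : polyAct (torusHom (ZMod p) δ).val (X 0 ^ r * X 2 ^ r) = X 0 ^ r * X 2 ^ r := by
      rw [map_mul, map_pow, map_pow, e0, e2, ← mul_pow, ← mul_pow, mul_mul_mul_comm, ← C_mul,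
        mul_inv_cancel₀ δ.ne_zero, C_1, one_mul]
    rw [key, ht, mul_one] at h
    rw [hc, ← h, one_mul]

lemma dicksonMap_injective {k : Type u} [Field k] (r : ℕ) :
    Function.Injective (dicksonMap k r) := by
  rw [injective_iff_map_eq_zero]
  obtain ⟨d0, d1, d2⟩ := dicksonMap_X (k := k) r
  have hL := mul_ne_zero (X_ne_zero (R := k) (0 : Fin 3)) (dicksonN_ne_zero r)
  intro f hf
  induction hn : f.totalDegree using Nat.strong_induction_on generalizing f with
  | _ n ih =>
  subst hn
  by_contra h0
  obtain ⟨g, rfl⟩ : X 0 ∣ f := by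
    rw [X_dvd_iff_aeval_update]
    have hpos : (r + 1) * (r + 2) = ((r + 1) * (r + 2) - 1) + 1 := by
      rw [Nat.sub_add_cancel]; exact Nat.mul_pos (by simp) (by simp)
    refine (isFrobSplit_pow (k := k) (m := 2) 1 ((r + 1) * (r + 2) - 1)).injective ?_
    rw [map_zero, ← hpos]
    have h1 := congrArg
      (aeval (Function.update (X : Fin 3 → MvPolynomial (Fin 3) k) 0 0)) hf
    rw [map_zero] at h1
    refine Eq.trans ?_ h1
    rw [← AlgHom.comp_apply, ← AlgHom.comp_apply]
    refine DFunLike.congr_fun (algHom_ext_three ?_ ?_ ?_) f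
    · rw [AlgHom.comp_apply, AlgHom.comp_apply, d0]
      simp [dicksonL]
    · rw [AlgHom.comp_apply, AlgHom.comp_apply, d1]
      simp [dicksonQ, dicksonN]
      ring
    · rw [AlgHom.comp_apply, AlgHom.comp_apply, d2]
      simp
  have hg : g ≠ 0 := right_ne_zero_of_mul h0
  rw [map_mul, d0] at hf
  refine hg (ih _ ?_ g ((mul_eq_zero.mp hf).resolve_left hL) rfl)
  rw [totalDegree_mul_of_isDomain (X_ne_zero _) hg, totalDegree_X]
  omega

lemma polyAct_dicksonMap (hp : p = r + 2) (h : GL (Fin 2) (ZMod p))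
    (f : MvPolynomial (Fin 3) (ZMod p)) :
    polyAct (blockHom (ZMod p) h).val (dicksonMap (ZMod p) r f) =
      dicksonMap (ZMod p) r (polyAct (torusHom (ZMod p) (GeneralLinearGroup.det h)).val f) := by
  rw [← AlgHom.comp_apply, ← AlgHom.comp_apply]
  congr 1
  obtain ⟨d0, d1, d2⟩ := dicksonMap_X (k := ZMod p) r
  obtain ⟨e0, e1, e2⟩ := polyAct_torusHom_X (GeneralLinearGroup.det h)
  obtain ⟨-, -, b2⟩ := polyAct_blockMat_X h.val
  refine algHom_ext_three ?_ ?_ ?_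
  · rw [AlgHom.comp_apply, AlgHom.comp_apply, e0, d0, map_mul, d0, algHom_C]
    exact polyAct_dicksonL hp _
  · rw [AlgHom.comp_apply, AlgHom.comp_apply, e1, d1]
    exact polyAct_dicksonQ hp (det_gl_ne_zero h)
  · rw [AlgHom.comp_apply, AlgHom.comp_apply, e2, d2, map_mul, d2, algHom_C]
    exact b2

lemma exists_isFrob_of_sl_le (hp : p = r + 2) (H : Subgroup (GL (Fin 2) (ZMod p)))
    (hH : ∀ s : GL (Fin 2) (ZMod p), s.val.det = 1 → s ∈ H) :
    ∃ (f : MvPolynomial (Fin 3) (ZMod p) →+* invariantRing (H.map (blockHom (ZMod p))))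
      (Φ : invariantRing (H.map (blockHom (ZMod p))) →+ MvPolynomial (Fin 3) (ZMod p)),
      IsFrob f Φ := by
  have hinj : Function.Injective (dicksonMap (ZMod p) r).toRingHom := dicksonMap_injective r
  refine exists_isFrob_transfer
    (K' := (H.map GeneralLinearGroup.det).map (torusHom (ZMod p)))
    (dicksonMap (ZMod p) r).toRingHom hinj
    (fun f hf => ?_) (fun f hf => ?_) (exists_isFrob_torus hp _)
  · rw [mem_invariantRing_iff] at hf ⊢
    rintro _ ⟨h, hh, rfl⟩
    refine (polyAct_dicksonMap hp h f).trans ?_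
    rw [hf _ (Subgroup.mem_map_of_mem _ (Subgroup.mem_map_of_mem _ hh))]
    rfl
  · rw [mem_invariantRing_iff] at hf
    obtain ⟨g, rfl⟩ := exists_dicksonMap_eq hp f fun s hs => by
      let s' := GeneralLinearGroup.mkOfDetNeZero s (hs.trans_ne one_ne_zero)
      have h1 := hf _ (Subgroup.mem_map_of_mem (blockHom (ZMod p)) (hH s' hs))
      exact h1
    refine ⟨g, mem_invariantRing_iff.mpr ?_, rfl⟩
    rintro _ ⟨_, ⟨h, hh, rfl⟩, rfl⟩
    exact dicksonMap_injective r ((polyAct_dicksonMap hp h g).symm.trans (hf _ (Subgroup.mem_map_of_mem _ hh)))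

lemma exists_isFrob_of_not_dvd (hp : p = r + 2) (H : Subgroup (GL (Fin 2) (ZMod p)))
    (hH : (Nat.card H : ZMod p) ≠ 0) :
    ∃ (f : MvPolynomial (Fin 3) (ZMod p) →+* invariantRing (H.map (blockHom (ZMod p))))
      (Φ : invariantRing (H.map (blockHom (ZMod p))) →+ MvPolynomial (Fin 3) (ZMod p)),
      IsFrob f Φ := by
  obtain ⟨Φ, hΦ, ht⟩ := isFrobSplit_dicksonHom (k := ZMod p) r
  refine exists_isFrob_of_card_ne_zero _ (card_map_ne_zero _ _ hH) hΦ ?_ ?_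
  · rintro _ ⟨h, -, rfl⟩ a
    exact polyAct_dicksonHom hp (det_gl_ne_zero h) a
  · rintro _ ⟨h, -, rfl⟩ x
    exact isFrob_apply_polyAct hp hΦ ht (det_gl_ne_zero h) x

end BlockSubgroups

section SpecialLinearTwo


lemma matrix_two_ext {k : Type u} {A B : Matrix (Fin 2) (Fin 2) k} (h00 : A 0 0 = B 0 0) (h01 : A 0 1 = B 0 1)
    (h10 : A 1 0 = B 1 0) (h11 : A 1 1 = B 1 1) : A = B := by
  rw [eta_fin_two A, eta_fin_two B, h00, h01, h10, h11]

variable {k : Type u} [Field k]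

/-- The square-zero matrix with image spanned by `w` and kernel spanned by `w`. -/
def vecNilp (w : Fin 2 → k) : Matrix (Fin 2) (Fin 2) k :=
  !![w 0 * w 1, -(w 0 * w 0); w 1 * w 1, -(w 0 * w 1)]

lemma vecNilp_mul_self (w : Fin 2 → k) : vecNilp w * vecNilp w = 0 := by
  apply matrix_two_ext <;> simp [vecNilp, mul_apply, Fin.sum_univ_two] <;> ring

lemma vecNilp_smul (c : k) (w : Fin 2 → k) : vecNilp (c • w) = (c * c) • vecNilp w := by
  apply matrix_two_ext <;> simp [vecNilp] <;> ring

lemma vecNilp_mulVec_mul (h : Matrix (Fin 2) (Fin 2) k) (w : Fin 2 → k) :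
    vecNilp (h *ᵥ w) * h = h.det • (h * vecNilp w) := by
  apply matrix_two_ext <;>
    simp [vecNilp, mul_apply, mulVec, dotProduct, Fin.sum_univ_two, det_fin_two] <;> ring

lemma vecNilp_mulVec (w v : Fin 2 → k) :
    vecNilp w *ᵥ v = (w 1 * v 0 - w 0 * v 1) • w := by
  ext i
  fin_cases i <;> simp [vecNilp, mulVec, dotProduct, Fin.sum_univ_two] <;> ring

lemma exists_eq_smul_vecNilp {N : Matrix (Fin 2) (Fin 2) k} (hN : IsNilpotent N) (h0 : N ≠ 0) :
    ∃ (α : k) (w : Fin 2 → k), α ≠ 0 ∧ w ≠ 0 ∧ N = α • vecNilp w := by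
  have ht := (isNilpotent_trace_of_isNilpotent hN).eq_zero
  have hd : N.det = 0 := by
    obtain ⟨n, hn⟩ := hN
    have := congrArg det hn
    rw [det_pow] at this
    by_cases h : n = 0
    · subst h
      exact absurd (by rw [← mul_one N, ← pow_zero N, hn, mul_zero]) h0
    · rw [det_zero] at this
      exact pow_eq_zero_iff h |>.mp this
  rw [trace_fin_two] at ht
  rw [det_fin_two] at hd
  have h11 : N 1 1 = -N 0 0 := by linear_combination ht
  rw [h11] at hd
  by_cases hc : N 1 0 = 0
  · rw [hc] at hd
    have ha : N 0 0 = 0 := by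
      have : N 0 0 * N 0 0 = 0 := by linear_combination -hd
      exact mul_self_eq_zero.mp this
    refine ⟨-N 0 1, ![1, 0], ?_, fun h => by simpa using congrFun h 0, ?_⟩
    · rw [neg_ne_zero]
      intro hb
      exact h0 (matrix_two_ext ha hb hc (by rw [h11, ha]; simp))
    · apply matrix_two_ext <;> simp [vecNilp, ha, hc, h11]
  · refine ⟨N 1 0, ![N 0 0 / N 1 0, 1], hc, fun h => by simpa using congrFun h 1, ?_⟩
    apply matrix_two_ext <;> simp [vecNilp, h11] <;> field_simp
    linear_combination -hd

lemma exists_unipotent_factorization (M : Submonoid (Matrix (Fin 2) (Fin 2) k))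
    (hU : ∀ a, !![1, a; 0, 1] ∈ M) (hL : ∀ a, !![1, 0; a, 1] ∈ M)
    (s : Matrix (Fin 2) (Fin 2) k) (hs : s.det = 1) : s ∈ M := by
  have main (s : Matrix (Fin 2) (Fin 2) k) (hs : s.det = 1) (hc : s 1 0 ≠ 0) : s ∈ M := by
    have : s = !![1, (s 0 0 - 1) / s 1 0; 0, 1] * !![1, 0; s 1 0, 1] *
        !![1, (s 1 1 - 1) / s 1 0; 0, 1] := by
      rw [det_fin_two] at hs
      apply matrix_two_ext <;> simp [mul_apply, Fin.sum_univ_two] <;> field_simp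
      · ring
      · linear_combination -hs
      · ring
    rw [this]
    exact M.mul_mem (M.mul_mem (hU _) (hL _)) (hU _)
  by_cases hc : s 1 0 = 0
  · have h1 : s 1 1 ≠ 0 := by
      rintro h1
      rw [det_fin_two, hc, h1] at hs
      simp at hs
    have : s = (s * !![1, 0; 1, 1]) * !![1, 0; -1, 1] := by
      rw [mul_assoc]
      have : (!![1, 0; 1, 1] * !![1, 0; -1, 1] : Matrix (Fin 2) (Fin 2) k) = 1 := by
        apply matrix_two_ext <;> simp [mul_apply, Fin.sum_univ_two]
      rw [this, mul_one]
    rw [this]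
    refine M.mul_mem (main _ ?_ ?_) (hL _)
    · rw [det_mul, hs]; simp [det_fin_two]
    · simpa [mul_apply, Fin.sum_univ_two, hc] using h1
  · exact main s hs hc

lemma area_ne_zero {w w' : Fin 2 → k} (hw0 : w ≠ 0) (hind : ∀ a : k, w' ≠ a • w) :
    w 1 * w' 0 - w 0 * w' 1 ≠ 0 := by
  intro hD
  by_cases h0 : w 0 = 0
  · have h1 : w 1 ≠ 0 := fun h1 => hw0 (by ext i; fin_cases i <;> simp [h0, h1])
    refine hind (w' 1 / w 1) ?_
    ext i
    fin_cases i
    · simpa [h0, h1] using hD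
    · simp [h1]
  · refine hind (w' 0 / w 0) ?_
    ext i
    fin_cases i
    · simp [h0]
    · simp
      field_simp
      linear_combination -hD

lemma exists_eq_smul_add_smul {w w' : Fin 2 → k} (hD : w 1 * w' 0 - w 0 * w' 1 ≠ 0)
    (v : Fin 2 → k) : ∃ b c : k, v = b • w + c • w' := by
  refine ⟨(v 1 * w' 0 - v 0 * w' 1) / (w 1 * w' 0 - w 0 * w' 1),
    (w 1 * v 0 - w 0 * v 1) / (w 1 * w' 0 - w 0 * w' 1), ?_⟩
  ext i
  fin_cases i <;>
    simp only [Pi.add_apply, Pi.smul_apply, smul_eq_mul, div_mul_eq_mul_div, ← add_div,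
      eq_div_iff hD, Fin.zero_eta, Fin.mk_one] <;> ring

variable {p : ℕ} [Fact p.Prime]

lemma special_mem_of_irreducible (H : Subgroup (GL (Fin 2) (ZMod p)))
    (hirr : ∀ w : Fin 2 → ZMod p, w ≠ 0 → ∃ h ∈ H, ∀ a : ZMod p, h.val *ᵥ w ≠ a • w)
    {x : GL (Fin 2) (ZMod p)} (hx : x ∈ H) (hx1 : x ≠ 1) (hxp : x ^ p = 1)
    (s : GL (Fin 2) (ZMod p)) (hs : s.val.det = 1) : s ∈ H := by
  let M : Submonoid (Matrix (Fin 2) (Fin 2) (ZMod p)) := H.toSubmonoid.map (Units.coeHom _)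
  have hM {h : GL (Fin 2) (ZMod p)} (hh : h ∈ H) : h.val ∈ M := ⟨h, hh, rfl⟩
  suffices h : s.val ∈ M by
    obtain ⟨t, ht, hts⟩ := h
    rwa [← Units.ext hts]
  have hconj (w) (hw : ∀ a : ZMod p, 1 + a • vecNilp w ∈ M) {h : GL (Fin 2) (ZMod p)} (hh : h ∈ H) (a : ZMod p) :
      1 + a • vecNilp (h.val *ᵥ w) ∈ M := by
    have key : (1 + a • vecNilp (h.val *ᵥ w)) * h.val =
        h.val * (1 + (a * h.val.det) • vecNilp w) := by
      rw [add_mul, smul_mul_assoc, vecNilp_mulVec_mul, mul_add, mul_smul_comm, smul_smul, one_mul,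
        mul_one]
    have : 1 + a • vecNilp (h.val *ᵥ w) =
        h.val * (1 + (a * h.val.det) • vecNilp w) * (h⁻¹).val := by
      rw [← key, mul_assoc, ← Units.val_mul, mul_inv_cancel, Units.val_one, mul_one]
    rw [this]
    exact M.mul_mem (M.mul_mem (hM hh) (hw _)) (hM (H.inv_mem hh))
  have hconj' (w) (hw : ∀ a : ZMod p, 1 + a • vecNilp w ∈ M) {m} (hm : m ∈ M) (a : ZMod p) :
      1 + a • vecNilp (m *ᵥ w) ∈ M := by
    obtain ⟨h, hh, rfl⟩ := hm
    exact hconj w hw hh a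
  have hsmul (w) (hw : ∀ a : ZMod p, 1 + a • vecNilp w ∈ M) (c a : ZMod p) :
      1 + a • vecNilp (c • w) ∈ M := by
    rw [vecNilp_smul, smul_smul]
    exact hw _
  obtain ⟨α, w, hα, hw0, hN⟩ : ∃ (α : ZMod p) (w : Fin 2 → ZMod p), α ≠ 0 ∧ w ≠ 0 ∧
      x.val - 1 = α • vecNilp w := by
    refine exists_eq_smul_vecNilp ⟨p, ?_⟩ ?_
    · rw [sub_pow_char_of_commute _ (Commute.one_right _), one_pow, ← Units.val_pow_eq_pow_val, hxp,
        Units.val_one, sub_self]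
    · intro h
      exact hx1 (Units.ext (sub_eq_zero.mp h))
  have hw (a : ZMod p) : 1 + a • vecNilp w ∈ M := by
    have hpow (n : ℕ) : x.val ^ n = 1 + (n * α) • vecNilp w := by
      have hx' : x.val = 1 + α • vecNilp w := by rw [← hN]; simp
      induction n with
      | zero => simp
      | succ n ih =>
        rw [pow_succ, ih, hx', add_mul, mul_add, mul_add, smul_mul_smul_comm, vecNilp_mul_self]
        push_cast
        rw [add_mul, add_smul]
        simp
        abel
    have := M.pow_mem (hM hx) (a / α).val
    rwa [hpow, ZMod.natCast_zmod_val, div_mul_cancel₀ _ hα] at this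
  obtain ⟨h, hh, hind⟩ := hirr w hw0
  set w' := h.val *ᵥ w with hw'
  have hw'M (a : ZMod p) := hconj w hw hh a
  rw [← hw'] at hw'M
  have hD := area_ne_zero hw0 hind
  have hall (v : Fin 2 → ZMod p) (a : ZMod p) : 1 + a • vecNilp v ∈ M := by
    obtain ⟨b, c, rfl⟩ := exists_eq_smul_add_smul hD v
    by_cases hc : c = 0
    · rw [hc, zero_smul, add_zero]
      exact hsmul w hw b a
    · have := hsmul _ (hconj' w' hw'M (hw (b / c / (w 1 * w' 0 - w 0 * w' 1)))) c a
      rw [add_mulVec, one_mulVec, smul_mulVec, vecNilp_mulVec, smul_smul,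
        div_mul_cancel₀ _ hD, smul_add, smul_smul, mul_div_cancel₀ _ hc, add_comm (c • w')] at this
      exact this
  refine exists_unipotent_factorization M (fun a => ?_) (fun a => ?_) s.val hs
  · convert hall ![1, 0] (-a) using 1
    apply matrix_two_ext <;> simp [vecNilp]
  · convert hall ![0, 1] a using 1
    apply matrix_two_ext <;> simp [vecNilp]

end SpecialLinearTwo

section Parabolic

/-- The upper left `2 × 2` block. -/
def leadMat {k : Type u} (M : Matrix (Fin 3) (Fin 3) k) : Matrix (Fin 2) (Fin 2) k :=
  !![M 0 0, M 0 1; M 1 0, M 1 1]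

/-- The matrices in `SL₃` preserving the line spanned by the last basis row vector. -/
def parabolic (k : Type u) [Field k] : Subgroup (SpecialLinearGroup (Fin 3) k) where
  carrier := {g | g.val 2 0 = 0 ∧ g.val 2 1 = 0}
  one_mem' := by simp
  mul_mem' := by
    rintro a b ⟨ha0, ha1⟩ ⟨hb0, hb1⟩
    simp [mul_apply, Fin.sum_univ_three, ha0, ha1, hb0, hb1]
  inv_mem' := by
    rintro a ⟨ha0, ha1⟩
    simp [adjugate_fin_three, ha0, ha1]

variable {k : Type u} [Field k]

lemma leadMat_mul (A : Matrix (Fin 3) (Fin 3) k) {B : Matrix (Fin 3) (Fin 3) k} (h0 : B 2 0 = 0)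
    (h1 : B 2 1 = 0) : leadMat (A * B) = leadMat A * leadMat B := by
  apply matrix_two_ext <;> simp [leadMat, mul_apply, Fin.sum_univ_two, Fin.sum_univ_three, h0, h1]

variable (k) in
/-- The Levi quotient of the parabolic subgroup. -/
def leadHom : parabolic k →* GL (Fin 2) k :=
  MonoidHom.toHomUnits
    { toFun := fun g => leadMat g.val.val
      map_one' := by apply matrix_two_ext <;> simp [leadMat]
      map_mul' := fun a b => leadMat_mul _ b.2.1 b.2.2 }

@[simp] lemma leadHom_val (g : parabolic k) : (leadHom k g).val = leadMat g.val.val := rfl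

lemma det_leadMat_mul (g : parabolic k) : (leadMat g.val.val).det * g.val.val 2 2 = 1 := by
  have h := g.val.2
  rw [det_fin_three, g.2.1, g.2.2] at h
  refine Eq.trans ?_ h
  rw [det_fin_two]
  simp [leadMat]
  ring

lemma parabolic_apply_ne_zero (g : parabolic k) : g.val.val 2 2 ≠ 0 :=
  right_ne_zero_of_mul_eq_one (det_leadMat_mul g)

/-- The elements of the unipotent radical of the parabolic subgroup. -/
def transl (v : Fin 2 → k) : SpecialLinearGroup (Fin 3) k :=
  ⟨!![1, 0, v 0; 0, 1, v 1; 0, 0, 1], by simp [det_fin_three]⟩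

lemma transl_add (v w : Fin 2 → k) : transl (v + w) = transl v * transl w := by
  refine Subtype.ext (?_ : !![_, _, _; _, _, _; _, _, _] = !![_, _, _; _, _, _; _, _, _] *
    !![_, _, _; _, _, _; _, _, _])
  ext i j
  fin_cases i <;> fin_cases j <;> simp [mul_apply, Fin.sum_univ_three, add_comm]

lemma transl_zero : transl (0 : Fin 2 → k) = 1 := by
  refine Subtype.ext (?_ : !![_, _, _; _, _, _; _, _, _] = _)
  ext i j
  fin_cases i <;> fin_cases j <;> simp

lemma eq_transl_of_leadHom_eq_one {g : parabolic k} (hg : leadHom k g = 1) :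
    ∃ v, g.val = transl v := by
  have h : leadMat g.val.val = 1 := congrArg Units.val hg
  have h2 := det_leadMat_mul g
  rw [h, det_one, one_mul] at h2
  have h00 := congrFun (congrFun h 0) 0
  have h01 := congrFun (congrFun h 0) 1
  have h10 := congrFun (congrFun h 1) 0
  have h11 := congrFun (congrFun h 1) 1
  simp [leadMat] at h00 h01 h10 h11
  refine ⟨![g.val.val 0 2, g.val.val 1 2], Subtype.ext
    (?_ : _ = !![_, _, _; _, _, _; _, _, _])⟩
  ext i j
  fin_cases i <;> fin_cases j <;> simp [h00, h01, h10, h11, h2, g.2.1, g.2.2]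

lemma mul_transl (g : parabolic k) (v : Fin 2 → k) :
    g.val * transl v =
      transl ((g.val.val 2 2)⁻¹ • (leadMat g.val.val *ᵥ v)) * g.val := by
  have h2 := parabolic_apply_ne_zero g
  refine Subtype.ext (?_ : _ * !![_, _, _; _, _, _; _, _, _] =
    !![_, _, _; _, _, _; _, _, _] * _)
  ext i j
  fin_cases i <;> fin_cases j <;>
    simp [mul_apply, Fin.sum_univ_three, leadMat, dotProduct, g.2.1, g.2.2] <;>
    field_simp
  all_goals ring

lemma transl_mul_blockHom (g : parabolic k) :
    g.val = transl ![(g.val.val 2 2)⁻¹ * g.val.val 0 2, (g.val.val 2 2)⁻¹ * g.val.val 1 2] *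
      blockHom k (leadHom k g) := by
  have h2 := parabolic_apply_ne_zero g
  have h3 : ((leadMat g.val.val).det)⁻¹ = g.val.val 2 2 :=
    inv_eq_of_mul_eq_one_right (det_leadMat_mul g)
  refine Subtype.ext (?_ : _ = !![_, _, _; _, _, _; _, _, _] * blockMat (leadMat g.val.val))
  rw [blockMat, h3]
  ext i j
  fin_cases i <;> fin_cases j <;>
    simp [mul_apply, Fin.sum_univ_three, leadMat, g.2.1, g.2.2] <;> field_simp

variable {p : ℕ} [Fact p.Prime]

/-- The image of `G` in the Levi quotient. -/
def leadImage (G : Subgroup (SpecialLinearGroup (Fin 3) k)) : Subgroup (GL (Fin 2) k) :=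
  (G.subgroupOf (parabolic k)).map (leadHom k)

lemma mem_leadImage {G : Subgroup (SpecialLinearGroup (Fin 3) k)} {h : GL (Fin 2) k} :
    h ∈ leadImage G ↔ ∃ g : parabolic k, g.val ∈ G ∧ leadHom k g = h := Iff.rfl

lemma mulVec_fin_three (M : Matrix (Fin 3) (Fin 3) k) (c : Fin 3 → k) (i : Fin 3) :
    (M *ᵥ c) i = M i 0 * c 0 + M i 1 * c 1 + M i 2 * c 2 := by
  simp [mulVec, dotProduct, Fin.sum_univ_three]

lemma exists_leadImage_mulVec_ne {G : Subgroup (SpecialLinearGroup (Fin 3) k)}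
    (hT : G ≤ parabolic k)
    (hE : ∀ c : Fin 3 → k, c ≠ 0 → ∃ g ∈ G, ∀ a : k, g.val *ᵥ c ≠ a • c)
    (w : Fin 2 → k) (hw : w ≠ 0) : ∃ h ∈ leadImage G, ∀ a : k, h.val *ᵥ w ≠ a • w := by
  obtain ⟨g, hg, h⟩ := hE ![w 0, w 1, 0] (fun h => hw (by
    have h0 := congrFun h 0
    have h1 := congrFun h 1
    ext i
    fin_cases i
    exacts [h0, h1]))
  refine ⟨leadHom k ⟨g, hT hg⟩, ⟨⟨g, hT hg⟩, hg, rfl⟩, fun a ha => h a ?_⟩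
  have h0 := congrFun ha 0
  have h1 := congrFun ha 1
  simp [leadMat, mulVec, dotProduct, Fin.sum_univ_two] at h0 h1
  ext i
  rw [mulVec_fin_three]
  fin_cases i
  · simp [h0]
  · simp [h1]
  · simp [(hT hg).1, (hT hg).2]

lemma transl_mem_of_mem {G : Subgroup (SpecialLinearGroup (Fin 3) (ZMod p))}
    (hirr : ∀ w : Fin 2 → ZMod p, w ≠ 0 → ∃ h ∈ leadImage G, ∀ a : ZMod p, h.val *ᵥ w ≠ a • w)
    {w : Fin 2 → ZMod p} (hw : w ≠ 0) (hwG : transl w ∈ G) (v : Fin 2 → ZMod p) :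
    transl v ∈ G := by
  have hsmul {w : Fin 2 → ZMod p} (hwG : transl w ∈ G) (a : ZMod p) : transl (a • w) ∈ G := by
    have (n : ℕ) : transl ((n : ZMod p) • w) ∈ G := by
      induction n with
      | zero => rw [Nat.cast_zero, zero_smul, transl_zero]; exact G.one_mem
      | succ n ih =>
        rw [Nat.cast_succ, add_smul, one_smul, transl_add]
        exact G.mul_mem ih hwG
    simpa using this a.val
  obtain ⟨_, ⟨g, hg, rfl⟩, hind⟩ := hirr w hw
  have hw' : transl ((leadHom _ g).val *ᵥ w) ∈ G := by
    have h1 := mul_inv_eq_of_eq_mul (mul_transl g w)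
    have h2 := hsmul (h1 ▸ G.mul_mem (G.mul_mem hg hwG) (G.inv_mem hg)) (g.val.val 2 2)
    rwa [smul_smul, mul_inv_cancel₀ (parabolic_apply_ne_zero g), one_smul] at h2
  obtain ⟨b, c, rfl⟩ := exists_eq_smul_add_smul (area_ne_zero hw hind) v
  rw [transl_add]
  exact G.mul_mem (hsmul hwG b) (hsmul hw' c)

lemma blockHom_leadHom_mem {G : Subgroup (SpecialLinearGroup (Fin 3) k)}
    (hN : ∀ v, transl v ∈ G) {g : parabolic k} (hg : g.val ∈ G) :
    blockHom k (leadHom k g) ∈ G := by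
  rw [transl_mul_blockHom g] at hg
  exact (G.mul_mem_cancel_left (hN _)).mp hg

end Parabolic

section UnipotentRadical

variable {k : Type u} [Field k]

lemma parabolic_mul_apply (g h : parabolic k) :
    (g * h).val.val 2 2 = g.val.val 2 2 * h.val.val 2 2 := by
  change (g.val.val * h.val.val) 2 2 = _
  simp [mul_apply, Fin.sum_univ_three, g.2.1, g.2.2]

lemma exists_eigenvector_of_card_ne_zero {G : Subgroup (SpecialLinearGroup (Fin 3) k)} [Finite G]
    (hT : G ≤ parabolic k) (hG : (Nat.card G : k) ≠ 0) :
    ∃ c : Fin 3 → k, c ≠ 0 ∧ ∀ g ∈ G, ∃ a : k, g.val *ᵥ c = a • c := by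
  have := Fintype.ofFinite G
  have hne (g : G) : g.val.val 2 2 ≠ 0 := parabolic_apply_ne_zero ⟨g, hT g.2⟩
  refine ⟨∑ g : G, (g.val.val 2 2)⁻¹ • (g.val.val *ᵥ Pi.single 2 1), fun h => hG ?_,
    fun g hg => ⟨g.val 2 2, ?_⟩⟩
  · have h2 := congrFun h 2
    rw [Finset.sum_apply] at h2
    simpa [hne] using h2
  · rw [mulVec_sum, Finset.smul_sum]
    refine Fintype.sum_equiv (Equiv.mulLeft ⟨g, hg⟩) _ _ fun x => ?_
    have h1 : (g * x.val).val 2 2 = g.val 2 2 * x.val.val 2 2 :=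
      parabolic_mul_apply ⟨g, hT hg⟩ ⟨x.val, hT x.2⟩
    change _ = g.val 2 2 • ((g * x.val).val 2 2)⁻¹ • ((g.val * x.val.val) *ᵥ Pi.single 2 1)
    rw [mulVec_smul, mulVec_mulVec, h1, smul_smul, mul_inv, mul_inv_cancel_left₀]
    exact hne ⟨g, hg⟩

lemma fixed_vector_unique {M : Matrix (Fin 3) (Fin 3) k}
    (hM : (1 - leadMat M).det ≠ 0) {c d : Fin 3 → k} (hc : M *ᵥ c = c) (hd : M *ᵥ d = d) :
    d 2 • c = c 2 • d := by
  have he : M *ᵥ (d 2 • c - c 2 • d) = d 2 • c - c 2 • d := by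
    rw [mulVec_sub, mulVec_smul, mulVec_smul, hc, hd]
  obtain ⟨e, rfl⟩ : ∃ e, e = d 2 • c - c 2 • d := ⟨_, rfl⟩
  set e := d 2 • c - c 2 • d with hdef
  have h2 : e 2 = 0 := by simp [hdef, mul_comm]
  have h0 : ![e 0, e 1] = 0 := by
    refine eq_zero_of_mulVec_eq_zero hM ?_
    have e0 := congrFun he 0
    have e1 := congrFun he 1
    rw [mulVec_fin_three, h2] at e0 e1
    rw [sub_mulVec, one_mulVec, sub_eq_zero]
    ext i
    fin_cases i
    · simp [leadMat]
      linear_combination -e0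
    · simp [leadMat]
      linear_combination -e1
  refine sub_eq_zero.mp ?_
  ext i
  fin_cases i
  exacts [congrFun h0 0, congrFun h0 1, h2]

lemma exists_fixed_vector {M : Matrix (Fin 3) (Fin 3) k} (h0 : M 2 0 = 0) (h1 : M 2 1 = 0)
    (h2 : M 2 2 = 1) (hM : (1 - leadMat M).det ≠ 0) : ∃ c : Fin 3 → k, c 2 = 1 ∧ M *ᵥ c = c := by
  obtain ⟨c, hc⟩ : ∃ c, (1 - leadMat M) *ᵥ c = ![M 0 2, M 1 2] :=
    ⟨(1 - leadMat M)⁻¹ *ᵥ _, by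
      rw [mulVec_mulVec, mul_nonsing_inv _ (Ne.isUnit hM), one_mulVec]⟩
  refine ⟨![c 0, c 1, 1], rfl, ?_⟩
  rw [sub_mulVec, one_mulVec] at hc
  have e0 := congrFun hc 0
  have e1 := congrFun hc 1
  simp [leadMat, dotProduct, Fin.sum_univ_two] at e0 e1
  ext i
  rw [mulVec_fin_three]
  fin_cases i
  · simp
    linear_combination -e0
  · simp
    linear_combination -e1
  · simp [h0, h1, h2]

lemma exists_eigenvector_of_normalizing {G : Subgroup (SpecialLinearGroup (Fin 3) k)}
    (hT : G ≤ parabolic k) {g : parabolic k} (hg : g.val.val 2 2 = 1)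
    (hz : (1 - (leadHom k g).val).det ≠ 0)
    (h : ∀ x : parabolic k, x.val ∈ G → ∃ n : ℕ, (1 - (leadHom k g ^ n).val).det ≠ 0 ∧
      x * g = g ^ n * x) :
    ∃ c : Fin 3 → k, c ≠ 0 ∧ ∀ g ∈ G, ∃ a : k, g.val *ᵥ c = a • c := by
  obtain ⟨c, hc2, hc⟩ := exists_fixed_vector g.2.1 g.2.2 hg hz
  have hpow (n : ℕ) : (g ^ n).val.val *ᵥ c = c := by
    induction n with
    | zero => simp
    | succ n ih =>
      rw [pow_succ]
      change ((g ^ n).val.val * g.val.val) *ᵥ c = c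
      rw [← mulVec_mulVec, hc, ih]
  refine ⟨c, fun h => by simp [h] at hc2, fun x hx => ?_⟩
  obtain ⟨n, hn, hxg⟩ := h ⟨x, hT hx⟩ hx
  have hfix : (g ^ n).val.val *ᵥ (x.val *ᵥ c) = x.val *ᵥ c := by
    have h1 : x.val * g.val.val = (g ^ n).val.val * x.val :=
      congrArg (fun y : parabolic k => y.val.val) hxg
    rw [mulVec_mulVec, ← h1, ← mulVec_mulVec, hc]
  rw [← map_pow] at hn
  refine ⟨(x.val *ᵥ c) 2, ?_⟩
  rw [fixed_vector_unique hn (hpow n) hfix, hc2, one_smul]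

lemma det_fibonacci : (!![0, 1; 1, 1] : Matrix (Fin 2) (Fin 2) (ZMod 2)).det = 1 ∧
    (1 - (!![0, 1; 1, 1] : Matrix (Fin 2) (Fin 2) (ZMod 2))).det ≠ 0 ∧
    (1 - (!![0, 1; 1, 1] : Matrix (Fin 2) (Fin 2) (ZMod 2)) ^ 2).det ≠ 0 := by
  decide

lemma mul_fibonacci (a b c d : ZMod 2) : a * d - b * c ≠ 0 →
    !![a, b; c, d] * !![0, 1; 1, 1] = !![0, 1; 1, 1] * !![a, b; c, d] ∨
    !![a, b; c, d] * !![0, 1; 1, 1] = !![0, 1; 1, 1] ^ 2 * !![a, b; c, d] := by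
  decide +revert

lemma exists_normalizing_two (p : ℕ) [Fact p.Prime] : ∃ z : GL (Fin 2) (ZMod p), z.val.det = 1 ∧
    (1 - z.val).det ≠ 0 ∧
    ∀ h : GL (Fin 2) (ZMod p), ∃ n : ℕ, (1 - (z ^ n).val).det ≠ 0 ∧ h * z = z ^ n * h := by
  by_cases hp : p = 2
  · subst hp
    obtain ⟨hz, hz1, hz2⟩ := det_fibonacci
    refine ⟨GeneralLinearGroup.mkOfDetNeZero _ (hz.trans_ne one_ne_zero), hz, hz1, fun h => ?_⟩
    have hd := det_gl_ne_zero h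
    rw [det_fin_two] at hd
    rcases mul_fibonacci _ _ _ _ hd with h1 | h1 <;> rw [← eta_fin_two h.val] at h1
    · exact ⟨1, by rwa [pow_one], Units.ext (by rwa [pow_one])⟩
    · exact ⟨2, hz2, Units.ext h1⟩
  · have h2 : (2 : ZMod p) ≠ 0 := by
      intro h
      have : ((2 : ℕ) : ZMod p) = 0 := by exact_mod_cast h
      rw [ZMod.natCast_eq_zero_iff] at this
      exact hp ((Nat.prime_dvd_prime_iff_eq Fact.out Nat.prime_two).mp this)
    have h1 : (1 - (-1 : GL (Fin 2) (ZMod p)).val).det ≠ 0 := by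
      rw [Units.val_neg, Units.val_one, sub_neg_eq_add, det_fin_two]
      simp
      rw [one_add_one_eq_two]
      exact h2
    refine ⟨-1, ?_, h1, fun h => ⟨1, by rwa [pow_one], by simp⟩⟩
    rw [Units.val_neg, Units.val_one, det_fin_two]
    simp

variable {p : ℕ} [Fact p.Prime]

lemma exists_transl_mem {G : Subgroup (SpecialLinearGroup (Fin 3) (ZMod p))}
    (hT : G ≤ parabolic (ZMod p))
    (hE : ∀ c : Fin 3 → ZMod p, c ≠ 0 → ∃ g ∈ G, ∀ a : ZMod p, g.val *ᵥ c ≠ a • c) :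
    ∃ v, v ≠ 0 ∧ transl v ∈ G := by
  by_contra! hN
  have hE' : ¬ ∃ c : Fin 3 → ZMod p, c ≠ 0 ∧ ∀ g ∈ G, ∃ a : ZMod p, g.val *ᵥ c = a • c := by
    push Not
    exact hE
  have hinj (x : parabolic (ZMod p)) (hx : x.val ∈ G) (h1 : leadHom _ x = 1) : x = 1 := by
    obtain ⟨v, hv⟩ := eq_transl_of_leadHom_eq_one h1
    have hv0 : v = 0 := by
      by_contra h0
      exact hN v h0 (hv ▸ hx)
    rw [hv0, transl_zero] at hv
    exact Subtype.ext hv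
  have hG : p ∣ Nat.card G := by
    by_contra h
    rw [← ZMod.natCast_eq_zero_iff] at h
    exact hE' (exists_eigenvector_of_card_ne_zero hT h)
  obtain ⟨g, hg⟩ := exists_prime_orderOf_dvd_card' p hG
  let x : parabolic (ZMod p) := ⟨g.val, hT g.2⟩
  have hxp : x ^ p = 1 := by
    have h : g ^ p = 1 := orderOf_dvd_iff_pow_eq_one.mp (dvd_of_eq hg)
    exact Subtype.ext (congrArg (fun y : G => y.val) h)
  have hx1 : leadHom _ x ≠ 1 := by
    intro h
    have h1 := hinj x g.2 h
    have : g = 1 := Subtype.ext (congrArg (fun y : parabolic (ZMod p) => y.val) h1)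
    rw [this, orderOf_one] at hg
    exact (Fact.out : p.Prime).one_lt.ne hg
  have hSL := special_mem_of_irreducible (leadImage G) (exists_leadImage_mulVec_ne hT hE)
    (mem_leadImage.mpr ⟨x, g.2, rfl⟩) hx1 (by rw [← map_pow, hxp, map_one])
  obtain ⟨z, hz1, hz, hzn⟩ := exists_normalizing_two p
  obtain ⟨y, hy, rfl⟩ := hSL z hz1
  refine hE' (exists_eigenvector_of_normalizing hT (g := y) ?_ hz fun w hw => ?_)
  · have := det_leadMat_mul y
    rw [leadHom_val] at hz1
    rwa [hz1, one_mul] at this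
  · obtain ⟨n, hn, h⟩ := hzn (leadHom _ w)
    refine ⟨n, hn, ?_⟩
    rw [← mul_inv_eq_one]
    refine hinj _ ?_ ?_
    · exact G.mul_mem (G.mul_mem hw hy) (G.inv_mem (G.mul_mem (G.pow_mem hy n) hw))
    · rw [map_mul, map_inv, map_mul, map_mul, map_pow, h, mul_inv_cancel]

end UnipotentRadical

section ParabolicInvariants

variable {p : ℕ} [Fact p.Prime] {r : ℕ}

/-- The endomorphism whose image is the ring of invariants of the unipotent radical. -/
def translMap (k : Type u) [Field k] (r : ℕ) :
    MvPolynomial (Fin 3) k →ₐ[k] MvPolynomial (Fin 3) k :=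
  aeval ![X 0 ^ (r + 2) - X 2 ^ (r + 1) * X 0, X 1 ^ (r + 2) - X 2 ^ (r + 1) * X 1, X 2]

lemma translMap_X {k : Type u} [Field k] (r : ℕ) :
    translMap k r (X 0) = X 0 ^ (r + 2) - X 2 ^ (r + 1) * X 0 ∧
    translMap k r (X 1) = X 1 ^ (r + 2) - X 2 ^ (r + 1) * X 1 ∧
    translMap k r (X 2) = X 2 := by
  simp [translMap]

lemma translMap_eq_comp (k : Type u) [Field k] (r : ℕ) :
    translMap k r = (aeval (R := k) (Function.update X 0 (X 0 ^ (r + 2) - X 2 ^ (r + 1) * X 0))).comp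
      (aeval (R := k) (Function.update X 1 (X 1 ^ (r + 2) - X 2 ^ (r + 1) * X 1))) := by
  obtain ⟨e0, e1, e2⟩ := translMap_X (k := k) r
  refine algHom_ext_three ?_ ?_ ?_
  · rw [e0]; simp
  · rw [e1]; simp
  · rw [e2]; simp

lemma aeval_update_pow_sub_injective {k : Type u} [Field k] {i : Fin 3} (hi : 2 ≠ i) (r : ℕ) :
    Function.Injective (aeval (R := k) (Function.update (X : Fin 3 → MvPolynomial (Fin 3) k) i
      (X i ^ (r + 2) - X 2 ^ (r + 1) * X i))) :=
  (isFrobSplit_pow_sub (k := k) (m := 2) i 2 hi (r + 1) (r + 1) (Nat.le_add_left 1 r)).injective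

lemma translMap_injective (k : Type u) [Field k] (r : ℕ) :
    Function.Injective (translMap k r) := by
  rw [translMap_eq_comp, AlgHom.coe_comp]
  exact (aeval_update_pow_sub_injective (by decide) r).comp
    (aeval_update_pow_sub_injective (by decide) r)

lemma polyAct_transl_X {k : Type u} [Field k] (v : Fin 2 → k) :
    polyAct (transl v).val (X 0) = X 0 + C (v 0) * X 2 ∧
    polyAct (transl v).val (X 1) = X 1 + C (v 1) * X 2 ∧
    polyAct (transl v).val (X 2) = X 2 := by
  have h : (transl v).val = !![1, 0, v 0; 0, 1, v 1; 0, 0, 1] := rfl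
  rw [h]
  refine ⟨?_, ?_, ?_⟩ <;> simp [polyAct_X, Fin.sum_univ_three]

lemma add_C_mul_pow (hp : p = r + 2) (a : ZMod p) (x y : MvPolynomial (Fin 3) (ZMod p)) :
    (x + C a * y) ^ (r + 2) = x ^ (r + 2) + C a * y ^ (r + 2) := by
  simpa using C_add_pow hp 1 a x y

lemma polyAct_transl_translMap (hp : p = r + 2) (v : Fin 2 → ZMod p)
    (f : MvPolynomial (Fin 3) (ZMod p)) :
    polyAct (transl v).val (translMap (ZMod p) r f) = translMap (ZMod p) r f := by
  rw [← AlgHom.comp_apply]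
  congr 1
  obtain ⟨e0, e1, e2⟩ := translMap_X (k := ZMod p) r
  obtain ⟨t0, t1, t2⟩ := polyAct_transl_X v
  refine algHom_ext_three ?_ ?_ ?_
  · rw [AlgHom.comp_apply, e0, map_sub, map_mul, map_pow, map_pow, t0, t2, add_C_mul_pow hp]
    ring
  · rw [AlgHom.comp_apply, e1, map_sub, map_mul, map_pow, map_pow, t1, t2, add_C_mul_pow hp]
    ring
  · rw [AlgHom.comp_apply, e2, t2]

lemma polyAct_blockHom_translMap (hp : p = r + 2) (h : GL (Fin 2) (ZMod p))
    (f : MvPolynomial (Fin 3) (ZMod p)) :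
    polyAct (blockHom (ZMod p) h).val (translMap (ZMod p) r f) =
      translMap (ZMod p) r (polyAct (blockHom (ZMod p) h).val f) := by
  rw [← AlgHom.comp_apply, ← AlgHom.comp_apply]
  congr 1
  obtain ⟨e0, e1, e2⟩ := translMap_X (k := ZMod p) r
  have hX := polyAct_blockMat_X h.val
  change polyAct (blockHom (ZMod p) h).val _ = _ ∧ polyAct (blockHom (ZMod p) h).val _ = _ ∧
    polyAct (blockHom (ZMod p) h).val _ = _ at hX
  obtain ⟨b0, b1, b2⟩ := hX
  have hC : (C (h.val.det)⁻¹ : MvPolynomial (Fin 3) (ZMod p)) ^ (r + 1) = 1 := by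
    rw [← map_pow, zmod_pow_sub_one hp (inv_ne_zero (det_gl_ne_zero h)), C_1]
  have hcomb (a b : ZMod p) : translMap (ZMod p) r (C a * X 0 + C b * X 1) =
      C a * (X 0 ^ (r + 2) - X 2 ^ (r + 1) * X 0) +
        C b * (X 1 ^ (r + 2) - X 2 ^ (r + 1) * X 1) := by
    rw [map_add, map_mul, map_mul, e0, e1, algHom_C, algHom_C, algebraMap_eq]
  refine algHom_ext_three ?_ ?_ ?_
  · rw [AlgHom.comp_apply, AlgHom.comp_apply, e0, b0, hcomb, map_sub, map_mul, map_pow, map_pow, b0,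
      b2, C_add_pow hp, mul_pow, hC]
    ring
  · rw [AlgHom.comp_apply, AlgHom.comp_apply, e1, b1, hcomb, map_sub, map_mul, map_pow, map_pow, b1,
      b2, C_add_pow hp, mul_pow, hC]
    ring
  · rw [AlgHom.comp_apply, AlgHom.comp_apply, e2, b2, map_mul, e2, algHom_C, algebraMap_eq]

lemma polyAct_transl_eq_aeval {k : Type u} [Field k] (a : k) :
    polyAct (transl ![a, 0]).val = aeval (R := k) (Function.update X 0 (X 0 + C a * X 2)) ∧
    polyAct (transl ![0, a]).val = aeval (R := k) (Function.update X 1 (X 1 + C a * X 2)) := by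
  obtain ⟨t0, t1, t2⟩ := polyAct_transl_X ![a, 0]
  obtain ⟨s0, s1, s2⟩ := polyAct_transl_X ![0, a]
  refine ⟨algHom_ext_three ?_ ?_ ?_, algHom_ext_three ?_ ?_ ?_⟩
  · rw [t0]; simp
  · rw [t1]; simp
  · rw [t2]; simp
  · rw [s0]; simp
  · rw [s1]; simp
  · rw [s2]; simp

lemma exists_of_shift_invariant_three (hp : p = r + 2) {i : Fin 3} (hi : 2 ≠ i)
    (f : MvPolynomial (Fin 3) (ZMod p))
    (hf : ∀ a : ZMod p, aeval (R := ZMod p) (Function.update X i (X i + C a * X 2)) f = f) :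
    ∃ g, aeval (R := ZMod p) (Function.update X i (X i ^ (r + 2) - X 2 ^ (r + 1) * X i)) g = f := by
  have h := exists_of_shift_invariant (m := 2) hi f hf
  rwa [show p - 1 = r + 1 by omega, congrArg (fun n : ℕ => (X i : MvPolynomial _ (ZMod p)) ^ n) hp]
    at h

lemma exists_translMap_eq (hp : p = r + 2) {f : MvPolynomial (Fin 3) (ZMod p)}
    (hf : ∀ v : Fin 2 → ZMod p, polyAct (transl v).val f = f) :
    ∃ g, translMap (ZMod p) r g = f := by
  obtain ⟨g, hg⟩ := exists_of_shift_invariant_three hp (i := 0) (by decide) f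
    fun a => by rw [← (polyAct_transl_eq_aeval a).1, hf]
  have hinj := aeval_update_pow_sub_injective (k := ZMod p) (i := 0) (by decide) r
  obtain ⟨g', hg'⟩ := exists_of_shift_invariant_three hp (i := 1) (by decide) g
    fun a => hinj (by
      rw [hg]
      refine Eq.trans ?_ (hf ![0, a])
      rw [(polyAct_transl_eq_aeval a).2, ← hg, ← AlgHom.comp_apply, ← AlgHom.comp_apply]
      refine DFunLike.congr_fun (algHom_ext_three ?_ ?_ ?_) g <;> simp)
  refine ⟨g', ?_⟩
  rw [translMap_eq_comp, AlgHom.comp_apply, hg', hg]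

lemma exists_isFrob_of_le_parabolic (hp : p = r + 2)
    {G : Subgroup (SpecialLinearGroup (Fin 3) (ZMod p))} (hT : G ≤ parabolic (ZMod p))
    (hE : ∀ c : Fin 3 → ZMod p, c ≠ 0 → ∃ g ∈ G, ∀ a : ZMod p, g.val *ᵥ c ≠ a • c) :
    ∃ (f : MvPolynomial (Fin 3) (ZMod p) →+* invariantRing G)
      (Φ : invariantRing G →+ MvPolynomial (Fin 3) (ZMod p)), IsFrob f Φ := by
  have hirr := exists_leadImage_mulVec_ne hT hE
  obtain ⟨v, hv, hvG⟩ := exists_transl_mem hT hE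
  have hN := transl_mem_of_mem hirr hv hvG
  have hinj : Function.Injective (translMap (ZMod p) r).toRingHom := translMap_injective _ r
  refine exists_isFrob_transfer (K' := (leadImage G).map (blockHom (ZMod p)))
    (translMap (ZMod p) r).toRingHom hinj (fun f hf => ?_) (fun f hf => ?_) ?_
  · rw [mem_invariantRing_iff] at hf ⊢
    intro g hg
    have h1 := hf _ (Subgroup.mem_map_of_mem _ (mem_leadImage.mpr ⟨⟨g, hT hg⟩, hg, rfl⟩))
    have h2 := congrArg Subtype.val (transl_mul_blockHom ⟨g, hT hg⟩)
    change polyAct g.val (translMap (ZMod p) r f) = translMap (ZMod p) r f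
    refine (congrArg (fun M => polyAct M (translMap (ZMod p) r f)) h2).trans ?_
    refine (polyAct_mul_apply _ _ _).trans ?_
    rw [polyAct_transl_translMap hp, polyAct_blockHom_translMap hp, h1]
  · rw [mem_invariantRing_iff] at hf
    obtain ⟨g, rfl⟩ := exists_translMap_eq hp fun v => hf _ (hN v)
    refine ⟨g, mem_invariantRing_iff.mpr ?_, rfl⟩
    rintro _ ⟨_, ⟨h, hh, rfl⟩, rfl⟩
    exact translMap_injective _ r ((polyAct_blockHom_translMap hp _ g).symm.trans
      (hf _ (blockHom_leadHom_mem hN hh)))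
  · by_cases hc : (Nat.card (leadImage G) : ZMod p) = 0
    · rw [ZMod.natCast_eq_zero_iff] at hc
      obtain ⟨x, hx⟩ := exists_prime_orderOf_dvd_card' p hc
      have hxp : x ^ p = 1 := orderOf_dvd_iff_pow_eq_one.mp (dvd_of_eq hx)
      have hx1 : x.val ≠ 1 := by
        intro h
        have : x = 1 := Subtype.ext h
        rw [this, orderOf_one] at hx
        exact (Fact.out : p.Prime).one_lt.ne hx
      exact exists_isFrob_of_sl_le hp _ (special_mem_of_irreducible _ hirr x.2 hx1
        (congrArg (fun y : leadImage G => y.val) hxp))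
    · exact exists_isFrob_of_not_dvd hp _ hc

end ParabolicInvariants

section Conjugation

lemma exists_row_eq {k : Type u} [Field k] {v : Fin 3 → k} (hv : v ≠ 0) :
    ∃ P : SpecialLinearGroup (Fin 3) k, ∀ j, P.val 2 j = v j := by
  by_cases h2 : v 2 = 0
  · by_cases h1 : v 1 = 0
    · have h0 : v 0 ≠ 0 := fun h0 => hv (by ext i; fin_cases i <;> simp [h0, h1, h2])
      exact ⟨⟨!![0, 1, 0; 0, 0, (v 0)⁻¹; v 0, v 1, v 2], by simp [det_fin_three, h0]⟩,
        fun j => by fin_cases j <;> rfl⟩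
    · exact ⟨⟨!![(v 1)⁻¹, 0, 0; 0, 0, -1; v 0, v 1, v 2], by simp [det_fin_three, h1]⟩,
        fun j => by fin_cases j <;> rfl⟩
  · exact ⟨⟨!![(v 2)⁻¹, 0, 0; 0, 1, 0; v 0, v 1, v 2], by simp [det_fin_three, h2]⟩,
      fun j => by fin_cases j <;> rfl⟩

variable {k : Type u} [Field k]

lemma exists_mulVec_ne {G : Subgroup (SpecialLinearGroup (Fin 3) k)}
    (hno2 : ∀ U : Submodule k (Fin 3 → k),
      (∀ g ∈ G, ∀ x ∈ U, x ᵥ* (g : Matrix (Fin 3) (Fin 3) k) ∈ U) → Module.finrank k U ≠ 2)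
    (c : Fin 3 → k) (hc : c ≠ 0) : ∃ g ∈ G, ∀ a : k, g.val *ᵥ c ≠ a • c := by
  by_contra! h
  have hd : (dotProductBilin k k).flip c ≠ (0 : Module.Dual k (Fin 3 → k)) := by
    intro h0
    refine hc (funext fun i => ?_)
    simpa using LinearMap.congr_fun h0 (Pi.single i 1)
  refine hno2 (LinearMap.ker ((dotProductBilin k k).flip c)) (fun g hg x hx => ?_) ?_
  · obtain ⟨a, ha⟩ := h g hg
    have hx' : x ⬝ᵥ c = 0 := hx
    change (x ᵥ* g.val) ⬝ᵥ c = 0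
    rw [← dotProduct_mulVec, ha, dotProduct_smul, hx', smul_zero]
  · have := Module.Dual.finrank_ker_add_one_of_ne_zero hd
    simpa using this

lemma exists_isFrob_of_conj {G : Subgroup (SpecialLinearGroup (Fin 3) k)}
    (P : SpecialLinearGroup (Fin 3) k)
    (h : ∃ (f : MvPolynomial (Fin 3) k →+* invariantRing (G.map (MulAut.conj P).toMonoidHom))
      (Φ : invariantRing (G.map (MulAut.conj P).toMonoidHom) →+ MvPolynomial (Fin 3) k),
      IsFrob f Φ) :
    ∃ (f : MvPolynomial (Fin 3) k →+* invariantRing G)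
      (Φ : invariantRing G →+ MvPolynomial (Fin 3) k), IsFrob f Φ := by
  have hmul (A B : SpecialLinearGroup (Fin 3) k) (f) :
      polyAct B.val (polyAct A.val f) = polyAct (A * B).val f := (polyAct_mul_apply _ _ _).symm
  have hone (f : MvPolynomial (Fin 3) k) :
      polyAct (1 : SpecialLinearGroup (Fin 3) k).val f = f := polyAct_one_apply f
  have hinv (f) : polyAct P.val (polyAct (P⁻¹).val f) = f := by
    rw [hmul, inv_mul_cancel, hone]
  have hinv' (f) : polyAct (P⁻¹).val (polyAct P.val f) = f := by
    rw [hmul, mul_inv_cancel, hone]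
  refine exists_isFrob_transfer (polyAct P.val).toRingHom (Function.LeftInverse.injective hinv')
    (fun f hf => ?_) (fun f hf => ⟨polyAct (P⁻¹).val f, ?_, hinv f⟩) h
  · rw [mem_invariantRing_iff] at hf ⊢
    intro g hg
    change polyAct g.val (polyAct P.val f) = polyAct P.val f
    have h1 : polyAct (P * g * P⁻¹).val f = f := hf _ ⟨g, hg, rfl⟩
    rw [hmul, ← inv_mul_cancel_right (P * g) P, ← hmul, h1]
  · rw [mem_invariantRing_iff] at hf ⊢
    rintro _ ⟨g, hg, rfl⟩
    change polyAct (P * g * P⁻¹).val _ = _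
    rw [hmul, ← mul_assoc, ← mul_assoc, inv_mul_cancel, one_mul, ← hmul, hf g hg]

end Conjugation

/-- If `𝔽_p·v₀` is a 1-dimensional `G`-submodule of `V = 𝔽_p³`,
`G ⊆ SL(3, 𝔽_p)`, `V` has no 2-dimensional `G`-submodule, and `V/𝔽_p·v₀` is an irreducible
`G`-module, then `S(V)^G` is Gorenstein. -/
theorem stmt18 (p : ℕ) [Fact p.Prime]
    (G : Subgroup (Matrix.SpecialLinearGroup (Fin 3) (ZMod p)))
    (v₀ : Fin 3 → ZMod p) (hv₀ : v₀ ≠ 0)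
    (hstab : ∀ g ∈ G, v₀ ᵥ* (g : Matrix (Fin 3) (Fin 3) (ZMod p)) ∈
      Submodule.span (ZMod p) ({v₀} : Set (Fin 3 → ZMod p)))
    (hno2 : ∀ U : Submodule (ZMod p) (Fin 3 → ZMod p),
      (∀ g ∈ G, ∀ x ∈ U, x ᵥ* (g : Matrix (Fin 3) (Fin 3) (ZMod p)) ∈ U) →
      Module.finrank (ZMod p) U ≠ 2)
    (hirr : ∀ U : Submodule (ZMod p) (Fin 3 → ZMod p),
      Submodule.span (ZMod p) ({v₀} : Set (Fin 3 → ZMod p)) ≤ U →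
      (∀ g ∈ G, ∀ x ∈ U, x ᵥ* (g : Matrix (Fin 3) (Fin 3) (ZMod p)) ∈ U) →
      U = Submodule.span (ZMod p) ({v₀} : Set (Fin 3 → ZMod p)) ∨ U = ⊤) :
    IsGorensteinRing ↥(invariantRing G) := by
  obtain ⟨r, hp⟩ : ∃ r, p = r + 2 :=
    ⟨p - 2, (Nat.sub_add_cancel (Fact.out : p.Prime).two_le).symm⟩
  obtain ⟨P, hP⟩ := exists_row_eq hv₀
  have hPP : P.val * (P⁻¹).val = 1 := congrArg (fun y => y.val) (mul_inv_cancel P)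
  have hPv : Pi.single 2 1 ᵥ* P.val = v₀ := by
    ext j
    rw [single_one_vecMul, row_apply, hP]
  have hT : G.map (MulAut.conj P).toMonoidHom ≤ parabolic (ZMod p) := by
    rintro _ ⟨g, hg, rfl⟩
    obtain ⟨a, ha⟩ := Submodule.mem_span_singleton.mp (hstab g hg)
    have h1 : Pi.single 2 1 ᵥ* (P * g * P⁻¹).val = a • Pi.single 2 1 := by
      change Pi.single 2 1 ᵥ* (P.val * g.val * (P⁻¹).val) = _
      rw [← vecMul_vecMul, ← vecMul_vecMul, hPv, ← ha, smul_vecMul, ← hPv, vecMul_vecMul]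
      rw [hPP, vecMul_one]
    rw [single_one_vecMul] at h1
    exact ⟨by simpa using congrFun h1 0, by simpa using congrFun h1 1⟩
  have hE := exists_mulVec_ne hno2
  obtain ⟨f, Φ, hf⟩ := exists_isFrob_of_conj P (exists_isFrob_of_le_parabolic hp hT fun c hc => by
    have hinv (c : Fin 3 → ZMod p) : P.val *ᵥ ((P⁻¹).val *ᵥ c) = c := by
      rw [mulVec_mulVec, hPP, one_mulVec]
    obtain ⟨g, hg, h⟩ := hE ((P⁻¹).val *ᵥ c) fun h0 => hc (by rw [← hinv c, h0, mulVec_zero])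
    refine ⟨_, ⟨g, hg, rfl⟩, fun a ha => h a ?_⟩
    replace ha : (P.val * g.val * (P⁻¹).val) *ᵥ c = a • c := ha
    rw [← mulVec_smul, ← ha, mulVec_mulVec, mulVec_mulVec]
    have h1 : P⁻¹ * (P * g * P⁻¹) = g * P⁻¹ := by rw [mul_assoc, inv_mul_cancel_left]
    exact congrArg (fun y => y.val *ᵥ c) h1.symm)
  exact hf.isGorensteinRing

end
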